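/- arXiv:2504.15014 — 3 statements merged into one kernel-verified Lean document; each statement's English description precedes it below -/
import Mathlib

section
/- The compact symplectic group Sp(4) is simply connected; in particular π₁(Sp(4)) is trivial. -/
/-- The compact symplectic group `Sp(n)`: the group of unitary `n × n` matrices over the
real quaternions, i.e. matrices `A` with `A * Aᴴ = 1`. -/
abbrev Sp (n : ℕ) : Type :=
  unitary (Matrix (Fin n) (Fin n) (Quaternion ℝ))

open Set
open scoped Matrix unitInterval

theorem IsSimplyConnected.homotopic {X : Type*} [TopologicalSpace X] {U : Set X}
    (hU : IsSimplyConnected U) {x y : X} (p q : Path x y) (hp : range p ⊆ U) (hq : range q ⊆ U) :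
    p.Homotopic q := by
  have := hU.simplyConnectedSpace
  rw [range_subset_iff] at hp hq
  have hx : x ∈ U := by simpa using hp 0
  have hy : y ∈ U := by simpa using hp 1
  let p' : Path (⟨x, hx⟩ : U) ⟨y, hy⟩ :=
    { toFun := fun t ↦ ⟨p t, hp t⟩, source' := by simp, target' := by simp }
  let q' : Path (⟨x, hx⟩ : U) ⟨y, hy⟩ :=
    { toFun := fun t ↦ ⟨q t, hq t⟩, source' := by simp, target' := by simp }
  exact (SimplyConnectedSpace.paths_homotopic p' q').map ⟨Subtype.val, continuous_subtype_val⟩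

open Path.Homotopic.Quotient in
/-- A compatible choice of homotopy classes of paths from a base point trivialises every path,
provided that it does so for paths staying inside one member of an open cover. -/
theorem Path.Homotopic.Quotient.trans_eq_of_openCover {X ι : Type*} [TopologicalSpace X]
    {U : ι → Set X} (hU : ∀ i, IsOpen (U i)) (hcover : ⋃ i, U i = univ) {x₀ : X}
    (c : ∀ x, Path.Homotopic.Quotient x₀ x)
    (hc : ∀ i {x y : X} (p : Path x y), range p ⊆ U i → (c x).trans (mk p) = c y)
    {x y : X} (γ : Path x y) : (c x).trans (mk γ) = c y := by
  obtain ⟨t, ht0, htm, ⟨n, hn⟩, ht⟩ := exists_monotone_Icc_subset_open_cover_unitInterval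
    (fun i ↦ (hU i).preimage γ.continuous) (by rw [← preimage_iUnion, hcover, preimage_univ])
  have key (m : ℕ) : (c (γ (t 0))).trans (mk (γ.subpath (t 0) (t m))) = c (γ (t m)) := by
    induction m with
    | zero => simp
    | succ m ih =>
      obtain ⟨i, hi⟩ := ht m
      rw [← Path.Homotopic.Quotient.eq.2 ⟨Path.Homotopy.subpathTransSubpath γ (t 0) (t m) _⟩,
        mk_trans, ← trans_assoc, ih]
      refine hc i _ ?_
      rw [Path.range_subpath_of_le _ _ _ (htm m.le_succ)]
      exact image_subset_iff.2 hi
  have := key n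
  rw [ht0, hn n le_rfl, Path.subpath_zero_one] at this
  have cast {a b : X} (ha : a = x) (hb : b = y)
      (h : (c a).trans (mk (γ.cast ha hb)) = c b) : (c x).trans (mk γ) = c y := by
    subst ha hb
    exact h
  exact cast γ.source γ.target this

open Path.Homotopic.Quotient in
/-- The simply connected case of the Seifert–van Kampen theorem. -/
theorem simplyConnectedSpace_of_union {X : Type*} [TopologicalSpace X] {U V : Set X}
    (hUo : IsOpen U) (hVo : IsOpen V) (hUV : U ∪ V = univ) (hU : IsSimplyConnected U)
    (hV : IsSimplyConnected V) (hI : IsPathConnected (U ∩ V)) : SimplyConnectedSpace X := by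
  obtain ⟨x₀, hx₀⟩ := hI.nonempty
  have path {W : Set X} (hW : IsPathConnected W) {x y : X} (hx : x ∈ W) (hy : y ∈ W) :
      ∃ p : Path x y, range p ⊆ W :=
    let h := hW.joinedIn x hx y hy
    ⟨h.somePath, range_subset_iff.2 h.somePath_mem⟩
  let W (b : Bool) : Set X := cond b U V
  have hWo (b) : IsOpen (W b) := by cases b <;> assumption
  have hW (b) : IsSimplyConnected (W b) := by cases b <;> assumption
  have hx₀W (b) : x₀ ∈ W b := by cases b; exacts [hx₀.2, hx₀.1]
  have hcover : ⋃ b, W b = univ := by rw [← hUV, union_eq_iUnion]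
  have exc (x : X) : ∃ q : Path.Homotopic.Quotient x₀ x,
      ∀ b, ∀ p : Path x₀ x, range p ⊆ W b → mk p = q := by
    by_cases hx : x ∈ U ∩ V
    · obtain ⟨p, hp⟩ := path hI hx₀ hx
      refine ⟨mk p, fun b q hq ↦ Path.Homotopic.Quotient.eq.2 ((hW b).homotopic q p hq ?_)⟩
      cases b
      exacts [hp.trans inter_subset_right, hp.trans inter_subset_left]
    · obtain ⟨b, hb⟩ := mem_iUnion.1 (hcover ▸ mem_univ x)
      obtain ⟨p, hp⟩ := path (hW b).isPathConnected (hx₀W b) hb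
      refine ⟨mk p, fun b' q hq ↦ ?_⟩
      obtain rfl : b' = b := by
        have hb' : x ∈ W b' := hq ⟨1, q.target⟩
        match b, b' with
        | true, true | false, false => rfl
        | true, false => exact (hx ⟨hb, hb'⟩).elim
        | false, true => exact (hx ⟨hb', hb⟩).elim
      exact Path.Homotopic.Quotient.eq.2 ((hW b').homotopic q p hq hp)
  choose c hc using exc
  have key {x y : X} (γ : Path x y) : (c x).trans (mk γ) = c y := by
    refine trans_eq_of_openCover hWo hcover c (fun b x y p hp ↦ ?_) γ
    have hx : x ∈ W b := hp ⟨0, p.source⟩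
    obtain ⟨q, hq⟩ := path (hW b).isPathConnected (hx₀W b) hx
    rw [← hc x b q hq, ← mk_trans]
    exact hc y b _ (by rw [Path.trans_range]; exact union_subset hq hp)
  refine simply_connected_iff_paths_homotopic.2 ⟨?_, fun x y ↦ ⟨fun p q ↦ ?_⟩⟩
  · refine ⟨⟨x₀⟩, fun x y ↦ ?_⟩
    obtain ⟨p, -⟩ := mk_surjective (c x)
    obtain ⟨q, -⟩ := mk_surjective (c y)
    exact ⟨p.symm.trans q⟩
  · obtain ⟨p, rfl⟩ := mk_surjective p
    obtain ⟨q, rfl⟩ := mk_surjective q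
    have h := (key p).trans (key q).symm
    replace h := congrArg ((symm (c x)).trans ·) h
    simpa [← trans_assoc] using h

theorem SimplyConnectedSpace.of_retract {X Y : Type*} [TopologicalSpace X] [TopologicalSpace Y]
    [SimplyConnectedSpace Y] {s : X → Y} {r : Y → X} (hs : Continuous s) (hr : Continuous r)
    (h : Function.LeftInverse r s) : SimplyConnectedSpace X := by
  refine simply_connected_iff_paths_homotopic'.2
    ⟨h.surjective.pathConnectedSpace hr, fun {x y} p q ↦ ?_⟩
  have := (SimplyConnectedSpace.paths_homotopic (p.map hs) (q.map hs)).map ⟨r, hr⟩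
  convert this.pathCast (h x).symm (h y).symm <;> ext t <;> simp [h _]

instance SimplyConnectedSpace.prod {X Y : Type*} [TopologicalSpace X] [TopologicalSpace Y]
    [SimplyConnectedSpace X] [SimplyConnectedSpace Y] : SimplyConnectedSpace (X × Y) := by
  refine simply_connected_iff_paths_homotopic.2 ⟨inferInstance, fun x y ↦ ⟨fun p q ↦ ?_⟩⟩
  rw [← Path.Homotopic.prod_projLeft_projRight p, ← Path.Homotopic.prod_projLeft_projRight q]
  congr 1 <;> exact Subsingleton.elim _ _

section Householder

open Quaternion

variable {k : Type*}

/-- The squared Euclidean norm of a quaternionic vector. -/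
def vecNormSq [Fintype k] (v : k → Quaternion ℝ) : ℝ := ∑ i, normSq (v i)

theorem star_dotProduct_self_eq_vecNormSq [Fintype k] (v : k → Quaternion ℝ) :
    star v ⬝ᵥ v = (vecNormSq v : ℝ) := by
  simp only [dotProduct, vecNormSq, Pi.star_apply, star_mul_self]
  exact (map_sum (algebraMap ℝ (Quaternion ℝ)) _ _).symm

theorem vecNormSq_pos [Fintype k] {v : k → Quaternion ℝ} (hv : v ≠ 0) : 0 < vecNormSq v := by
  obtain ⟨i, hi⟩ := Function.ne_iff.1 hv
  exact Finset.sum_pos' (fun _ _ ↦ normSq_nonneg)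
    ⟨i, Finset.mem_univ i, normSq_nonneg.lt_of_ne' (normSq_ne_zero.2 hi)⟩

theorem vecNormSq_smul [Fintype k] (r : ℝ) (v : k → Quaternion ℝ) :
    vecNormSq (r • v) = r ^ 2 * vecNormSq v := by
  simp [vecNormSq, normSq_smul, Finset.mul_sum]

theorem continuous_vecNormSq [Fintype k] : Continuous (vecNormSq (k := k)) :=
  continuous_finsetSum _ fun i _ ↦ continuous_normSq.comp (continuous_apply i)

theorem vecNormSq_single [Fintype k] [DecidableEq k] (i₀ : k) :
    vecNormSq (Pi.single i₀ 1 : k → Quaternion ℝ) = 1 := by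
  rw [vecNormSq, Finset.sum_eq_single i₀] <;> simp +contextual

theorem eq_single_of_vecNormSq_eq_one [Fintype k] [DecidableEq k] {v : k → Quaternion ℝ}
    (hv : vecNormSq v = 1) {i₀ : k} (h : v i₀ = 1) : v = Pi.single i₀ 1 := by
  rw [vecNormSq, ← Finset.add_sum_erase _ _ (Finset.mem_univ i₀), h, map_one, add_eq_left,
    Finset.sum_eq_zero_iff_of_nonneg fun _ _ ↦ normSq_nonneg] at hv
  ext1 i
  obtain rfl | hi := eq_or_ne i i₀
  · simp [h]
  · rw [Pi.single_eq_of_ne hi, ← normSq_eq_zero]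
    exact hv i (Finset.mem_erase.2 ⟨hi, Finset.mem_univ i⟩)

/-- The quaternionic quasi-reflection carrying the basis vector `Pi.single i₀ 1` to the unit
vector `v`. -/
noncomputable def householder [DecidableEq k] (i₀ : k) (v : k → Quaternion ℝ) :
    Matrix k k (Quaternion ℝ) :=
  1 - Matrix.vecMulVec (fun i ↦ (Pi.single i₀ 1 - v : k → Quaternion ℝ) i * (1 - star (v i₀))⁻¹)
    (star (Pi.single i₀ 1 - v))

theorem householder_apply_self [DecidableEq k] {i₀ : k} {v : k → Quaternion ℝ} (h : v i₀ ≠ 1)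
    (i : k) : householder i₀ v i i₀ = v i := by
  have h' : 1 - star (v i₀) ≠ 0 := by
    rw [sub_ne_zero]
    exact fun h' ↦ h (by simpa using congrArg star h'.symm)
  simp [householder, Matrix.vecMulVec_apply, mul_assoc, inv_mul_cancel₀ h', Matrix.one_apply,
    Pi.single_apply]

theorem householder_mem_unitary [Fintype k] [DecidableEq k] {i₀ : k} {v : k → Quaternion ℝ}
    (hv : vecNormSq v = 1) (h : v i₀ ≠ 1) : householder i₀ v ∈ unitary (Matrix k k (Quaternion ℝ)) := by
  set a : Quaternion ℝ := 1 - star (v i₀) with ha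
  set u : k → Quaternion ℝ := Pi.single i₀ 1 - v with hu
  have ha0 : a ≠ 0 := by
    rw [ha, sub_ne_zero]
    exact fun h' ↦ h (by simpa using congrArg star h'.symm)
  have hd : star u ⬝ᵥ u = a + star a := by
    rw [hu, star_sub, sub_dotProduct, dotProduct_sub, dotProduct_sub,
      star_dotProduct_self_eq_vecNormSq, star_dotProduct_self_eq_vecNormSq, hv, vecNormSq_single,
      ← Pi.single_star]
    simp only [ha, single_dotProduct, dotProduct_single]
    simp
    abel
  have hP : householder i₀ v = 1 - Matrix.vecMulVec (fun i ↦ u i * a⁻¹) (star u) := rfl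
  set P := Matrix.vecMulVec (fun i ↦ u i * a⁻¹) (star u) with hPdef
  have hPs : star P = Matrix.vecMulVec u (star fun i ↦ u i * a⁻¹) := by
    rw [hPdef, Matrix.star_eq_conjTranspose, Matrix.conjTranspose_vecMulVec, star_star]
  have hsa0 : star a ≠ 0 := star_ne_zero.2 ha0
  have h1 : a⁻¹ * ((a + star a) * (star a)⁻¹) = a⁻¹ + (star a)⁻¹ := by
    rw [add_mul, mul_add, inv_mul_cancel_left₀ ha0, mul_inv_cancel₀ hsa0, mul_one, add_comm]
  have h2 : (star a)⁻¹ * ((a + star a) * a⁻¹) = a⁻¹ + (star a)⁻¹ := by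
    rw [add_mul, mul_add, inv_mul_cancel_left₀ hsa0, mul_inv_cancel₀ ha0, mul_one, add_comm]
  have hPP : P * star P = P + star P := by
    rw [hPs, hPdef, Matrix.vecMulVec_mul_vecMulVec, hd]
    ext1 i j
    simp only [Matrix.vecMulVec_apply, Matrix.add_apply, Pi.smul_apply, smul_eq_mul, Pi.star_apply,
      star_mul, star_inv₀]
    calc _ = u i * (a⁻¹ * ((a + star a) * (star a)⁻¹)) * star (u j) := by simp only [mul_assoc]
      _ = _ := by rw [h1]; simp only [mul_add, add_mul, mul_assoc]
  have hc : (star fun i ↦ u i * a⁻¹) ⬝ᵥ (fun i ↦ u i * a⁻¹) = a⁻¹ + (star a)⁻¹ := by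
    rw [← h2, ← hd, dotProduct, dotProduct, Finset.sum_mul, Finset.mul_sum]
    simp [mul_assoc]
  have hPP' : star P * P = P + star P := by
    rw [hPs, hPdef, Matrix.vecMulVec_mul_vecMulVec, hc]
    ext1 i j
    simp [Matrix.vecMulVec_apply, mul_add, add_mul, mul_assoc]
  rw [hP, Unitary.mem_iff, star_sub, star_one]
  constructor
  · rw [sub_mul, mul_sub, mul_sub, hPP']; noncomm_ring
  · rw [sub_mul, mul_sub, mul_sub, hPP]; noncomm_ring

theorem continuousOn_householder [Fintype k] [DecidableEq k] (i₀ : k) :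
    ContinuousOn (householder i₀) {v : k → Quaternion ℝ | v i₀ ≠ 1} := by
  rw [continuousOn_iff_continuous_domRestrict]
  refine continuous_const.sub (Continuous.matrix_vecMulVec ?_ (by fun_prop))
  refine continuous_pi fun i ↦ Continuous.mul (by fun_prop) (Continuous.inv₀
    (continuous_const.sub ((continuous_apply i₀).comp continuous_subtype_val).star) ?_)
  rintro ⟨v, hv⟩ h
  rw [sub_eq_zero] at h
  exact hv (by simpa using congrArg star h.symm)

/-- The complement of the closed ray spanned by the basis vector `Pi.single i₀ 1`. -/
def rayCompl [DecidableEq k] (i₀ : k) : Set (k → Quaternion ℝ) :=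
  {w | ∀ r : ℝ, 0 ≤ r → w ≠ r • Pi.single i₀ 1}

theorem starConvex_rayCompl [DecidableEq k] (i₀ : k) : StarConvex ℝ (-Pi.single i₀ 1)
    (rayCompl i₀) := by
  intro w hw a b ha hb hab r hr h
  obtain rfl | hb := hb.eq_or_lt
  · have h := congrArg QuaternionAlgebra.re (congrFun h i₀)
    simp at h
    linarith
  · refine hw ((r + a) / b) (by positivity) ?_
    have hbw : b • w = (r + a) • Pi.single i₀ 1 := by
      rw [add_smul, ← h, smul_neg]
      abel
    rw [div_eq_inv_mul, mul_smul, ← hbw, inv_smul_smul₀ hb.ne']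

theorem neg_single_mem_rayCompl [DecidableEq k] (i₀ : k) : -Pi.single i₀ 1 ∈ rayCompl i₀ := by
  intro r hr h
  have h := congrArg QuaternionAlgebra.re (congrFun h i₀)
  simp at h
  linarith

instance [Fintype k] [DecidableEq k] (i₀ : k) : ContractibleSpace (rayCompl i₀) :=
  (starConvex_rayCompl i₀).contractibleSpace ⟨_, neg_single_mem_rayCompl i₀⟩

/-- The unit vector in the direction of `w`. -/
noncomputable def vecNormalize [Fintype k] (w : k → Quaternion ℝ) : k → Quaternion ℝ :=
  (√(vecNormSq w))⁻¹ • w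

theorem vecNormSq_vecNormalize [Fintype k] {w : k → Quaternion ℝ} (hw : w ≠ 0) :
    vecNormSq (vecNormalize w) = 1 := by
  have := vecNormSq_pos hw
  rw [vecNormalize, vecNormSq_smul, inv_pow, Real.sq_sqrt this.le, inv_mul_cancel₀ this.ne']

theorem vecNormalize_of_vecNormSq_eq_one [Fintype k] {w : k → Quaternion ℝ} (hw : vecNormSq w = 1) :
    vecNormalize w = w := by
  simp [vecNormalize, hw]

theorem sqrt_vecNormSq_smul_vecNormalize [Fintype k] {w : k → Quaternion ℝ} (hw : w ≠ 0) :
    √(vecNormSq w) • vecNormalize w = w :=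
  smul_inv_smul₀ (Real.sqrt_pos.2 (vecNormSq_pos hw)).ne' w

theorem continuousOn_vecNormalize [Fintype k] : ContinuousOn (vecNormalize (k := k)) {0}ᶜ :=
  ((Real.continuous_sqrt.comp continuous_vecNormSq).continuousOn.inv₀ fun _ hw ↦
    (Real.sqrt_pos.2 (vecNormSq_pos hw)).ne').smul continuousOn_id

theorem ne_zero_of_mem_rayCompl [DecidableEq k] {i₀ : k} {w : k → Quaternion ℝ}
    (hw : w ∈ rayCompl i₀) : w ≠ 0 :=
  fun h ↦ hw 0 le_rfl (by rw [h, zero_smul])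

theorem vecNormalize_apply_ne_one [Fintype k] [DecidableEq k] {i₀ : k} {w : k → Quaternion ℝ}
    (hw : w ∈ rayCompl i₀) :
    vecNormalize w i₀ ≠ 1 := by
  intro h
  have hw0 := ne_zero_of_mem_rayCompl hw
  refine hw _ (Real.sqrt_nonneg (vecNormSq w)) ?_
  rw [← eq_single_of_vecNormSq_eq_one (vecNormSq_vecNormalize hw0) h,
    sqrt_vecNormSq_smul_vecNormalize hw0]

/-- A continuous family of unitary matrices, parametrised by the complement of the ray through
`Pi.single i₀ 1`, whose column at `i₀` is the direction of the parameter. -/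
noncomputable def rayComplUnitary [Fintype k] [DecidableEq k] {i₀ : k} (w : rayCompl i₀) :
    unitary (Matrix k k (Quaternion ℝ)) :=
  ⟨householder i₀ (vecNormalize w), householder_mem_unitary
    (vecNormSq_vecNormalize (ne_zero_of_mem_rayCompl w.2)) (vecNormalize_apply_ne_one w.2)⟩

theorem continuous_rayComplUnitary [Fintype k] [DecidableEq k] (i₀ : k) :
    Continuous (rayComplUnitary : rayCompl i₀ → unitary (Matrix k k (Quaternion ℝ))) := by
  refine Continuous.subtype_mk ?_ _
  exact (continuousOn_householder i₀).comp_continuous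
    (continuousOn_vecNormalize.comp_continuous continuous_subtype_val
      fun w ↦ ne_zero_of_mem_rayCompl w.2) fun w ↦ vecNormalize_apply_ne_one w.2

theorem vecNormSq_col [Fintype k] [DecidableEq k] {A : Matrix k k (Quaternion ℝ)}
    (hA : A ∈ unitary (Matrix k k (Quaternion ℝ))) (i₀ : k) : vecNormSq (A.col i₀) = 1 := by
  have h : star (A.col i₀) ⬝ᵥ A.col i₀ = (1 : Matrix k k (Quaternion ℝ)) i₀ i₀ := by
    rw [← Unitary.star_mul_self_of_mem hA]
    rfl
  rw [Matrix.one_apply_eq, star_dotProduct_self_eq_vecNormSq] at h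
  exact coe_injective h

theorem mem_rayCompl_of_vecNormSq_eq_one [Fintype k] [DecidableEq k] {i₀ : k}
    {v : k → Quaternion ℝ} (hv : vecNormSq v = 1)
    (h : v ≠ Pi.single i₀ 1) : v ∈ rayCompl i₀ := by
  rintro r hr rfl
  refine h ?_
  rw [vecNormSq_smul, vecNormSq_single, mul_one] at hv
  rw [(pow_eq_one_iff_of_nonneg hr two_ne_zero).1 hv, one_smul]

end Householder

section Stabilizer

open Matrix

variable {ι : Type*} [Fintype ι] [DecidableEq ι]

/-- The embedding of `Sp(n)` into `Sp(n + 1)` as the stabilizer of the first basis vector. -/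
noncomputable def unitaryBlock (B : unitary (Matrix ι ι (Quaternion ℝ))) :
    unitary (Matrix (Unit ⊕ ι) (Unit ⊕ ι) (Quaternion ℝ)) :=
  ⟨fromBlocks 1 0 0 B, by
    have h₁ := Unitary.coe_star_mul_self B
    have h₂ := Unitary.coe_mul_star_self B
    rw [star_eq_conjTranspose] at h₁
    rw [Unitary.coe_star, star_eq_conjTranspose] at h₂
    simp [Unitary.mem_iff, star_eq_conjTranspose, fromBlocks_conjTranspose, fromBlocks_multiply,
      h₁, h₂]⟩

theorem continuous_unitaryBlock : Continuous (unitaryBlock (ι := ι)) :=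
  (Continuous.matrix_fromBlocks continuous_const continuous_const continuous_const
    continuous_subtype_val).subtype_mk _

theorem unitaryBlock_mulVec_single (B : unitary (Matrix ι ι (Quaternion ℝ))) :
    (unitaryBlock B).1 *ᵥ Pi.single (Sum.inl ()) 1 = Pi.single (Sum.inl ()) 1 := by
  rw [mulVec_single_one]
  ext1 (i | i) <;> simp [unitaryBlock]

theorem fromBlocks_toBlocks₂₂_of_mulVec_single {A : Matrix (Unit ⊕ ι) (Unit ⊕ ι) (Quaternion ℝ)}
    (hA : A ∈ unitary (Matrix (Unit ⊕ ι) (Unit ⊕ ι) (Quaternion ℝ)))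
    (h : A *ᵥ Pi.single (Sum.inl ()) 1 = Pi.single (Sum.inl ()) 1) :
    A.toBlocks₂₂ ∈ unitary (Matrix ι ι (Quaternion ℝ)) ∧ fromBlocks 1 0 0 A.toBlocks₂₂ = A := by
  rw [mulVec_single_one] at h
  have h₁₁ : A.toBlocks₁₁ = 1 := by
    ext1 i j
    simpa [toBlocks₁₁] using congrFun h (Sum.inl i)
  have h₂₁ : A.toBlocks₂₁ = 0 := by
    ext1 i j
    simpa [toBlocks₂₁] using congrFun h (Sum.inr i)
  have hA' := fromBlocks_toBlocks A
  rw [h₁₁, h₂₁] at hA'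
  have hl := Unitary.star_mul_self_of_mem hA
  have hr := Unitary.mul_star_self_of_mem hA
  rw [← hA', star_eq_conjTranspose, fromBlocks_conjTranspose, fromBlocks_multiply,
    ← fromBlocks_one, fromBlocks_inj] at hl hr
  have h₁₂ : A.toBlocks₁₂ = 0 := by simpa using hl.2.1
  rw [h₁₂] at hA'
  refine ⟨Unitary.mem_iff.2 ⟨?_, ?_⟩, hA'⟩
  · simpa [h₁₂, star_eq_conjTranspose] using hl.2.2.2
  · simpa [star_eq_conjTranspose] using hr.2.2.2

/-- The unitary matrices over a chart of the unit sphere: `(w, B)` is sent to a matrix whose first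
column is the direction of `w`. -/
noncomputable def unitaryChart
    (p : rayCompl (Sum.inl () : Unit ⊕ ι) × unitary (Matrix ι ι (Quaternion ℝ))) :
    unitary (Matrix (Unit ⊕ ι) (Unit ⊕ ι) (Quaternion ℝ)) :=
  rayComplUnitary p.1 * unitaryBlock p.2

theorem continuous_unitaryChart : Continuous (unitaryChart (ι := ι)) :=
  ((continuous_rayComplUnitary _).comp continuous_fst).mul
    (continuous_unitaryBlock.comp continuous_snd)

theorem rayComplUnitary_mulVec_single {k : Type*} [Fintype k] [DecidableEq k] {i₀ : k}
    (w : rayCompl i₀) : (rayComplUnitary w).1 *ᵥ Pi.single i₀ 1 = vecNormalize w := by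
  rw [mulVec_single_one]
  exact funext (householder_apply_self (vecNormalize_apply_ne_one w.2))

theorem col_unitaryChart
    (p : rayCompl (Sum.inl () : Unit ⊕ ι) × unitary (Matrix ι ι (Quaternion ℝ))) :
    (unitaryChart p).1.col (Sum.inl ()) = vecNormalize p.1 := by
  rw [← mulVec_single_one, unitaryChart, Submonoid.coe_mul, ← mulVec_mulVec,
    unitaryBlock_mulVec_single, rayComplUnitary_mulVec_single]

theorem star_rayComplUnitary_mul_mulVec_single {k : Type*} [Fintype k] [DecidableEq k] {i₀ : k}
    (A : unitary (Matrix k k (Quaternion ℝ))) (hA : A.1.col i₀ ∈ rayCompl i₀) :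
    (star (rayComplUnitary ⟨A.1.col i₀, hA⟩) * A).1 *ᵥ Pi.single i₀ 1 = Pi.single i₀ 1 := by
  have h := rayComplUnitary_mulVec_single ⟨A.1.col i₀, hA⟩
  rw [vecNormalize_of_vecNormSq_eq_one (vecNormSq_col A.2 i₀)] at h
  rw [Submonoid.coe_mul, ← mulVec_mulVec, mulVec_single_one A.1]
  refine (congrArg _ h.symm).trans ?_
  rw [mulVec_mulVec, ← Submonoid.coe_mul, Unitary.star_mul_self, Submonoid.coe_one, one_mulVec]

/-- The set of unitary matrices whose first column is not the first basis vector. -/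
def firstColNe (ι : Type*) [Fintype ι] [DecidableEq ι] :
    Set (unitary (Matrix (Unit ⊕ ι) (Unit ⊕ ι) (Quaternion ℝ))) :=
  {A | A.1.col (Sum.inl ()) ≠ Pi.single (Sum.inl ()) 1}

theorem continuous_col (i₀ : ι) :
    Continuous fun A : unitary (Matrix ι ι (Quaternion ℝ)) ↦ A.1.col i₀ := by
  refine continuous_pi fun i ↦ ?_
  exact (continuous_apply_apply i i₀).comp continuous_subtype_val

theorem isOpen_firstColNe : IsOpen (firstColNe ι) :=
  isOpen_ne_fun (continuous_col _) continuous_const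

theorem unitaryChart_mem_firstColNe
    (p : rayCompl (Sum.inl () : Unit ⊕ ι) × unitary (Matrix ι ι (Quaternion ℝ))) :
    unitaryChart p ∈ firstColNe ι := by
  intro h
  rw [col_unitaryChart] at h
  exact vecNormalize_apply_ne_one p.1.2 (by rw [h, Pi.single_eq_same])

theorem col_mem_rayCompl {A : unitary (Matrix (Unit ⊕ ι) (Unit ⊕ ι) (Quaternion ℝ))}
    (hA : A ∈ firstColNe ι) : A.1.col (Sum.inl ()) ∈ rayCompl (Sum.inl () : Unit ⊕ ι) :=
  mem_rayCompl_of_vecNormSq_eq_one (vecNormSq_col A.2 _) hA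

/-- The inverse of `unitaryChart` on matrices with a given first column of norm one. -/
noncomputable def unitaryChartSection (A : firstColNe ι) :
    rayCompl (Sum.inl () : Unit ⊕ ι) × unitary (Matrix ι ι (Quaternion ℝ)) :=
  ⟨⟨_, col_mem_rayCompl A.2⟩, ⟨_, (fromBlocks_toBlocks₂₂_of_mulVec_single (Subtype.prop _)
    (star_rayComplUnitary_mul_mulVec_single A.1 (col_mem_rayCompl A.2))).1⟩⟩

theorem unitaryChart_unitaryChartSection (A : firstColNe ι) :
    unitaryChart (unitaryChartSection A) = A.1 := by
  have h : unitaryBlock (unitaryChartSection A).2 =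
      star (rayComplUnitary (unitaryChartSection A).1) * A.1 :=
    Subtype.ext (fromBlocks_toBlocks₂₂_of_mulVec_single (Subtype.prop _)
      (star_rayComplUnitary_mul_mulVec_single A.1 (col_mem_rayCompl A.2))).2
  rw [unitaryChart, h, ← mul_assoc, Unitary.mul_star_self, one_mul]

theorem continuous_unitaryChartSection : Continuous (unitaryChartSection (ι := ι)) := by
  have h₁ : Continuous fun A : firstColNe ι ↦ (unitaryChartSection A).1 :=
    ((continuous_col _).comp continuous_subtype_val).subtype_mk _
  refine h₁.prodMk (Continuous.subtype_mk ?_ _)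
  have h₂ : Continuous fun A : firstColNe ι ↦
      star (rayComplUnitary (unitaryChartSection A).1) * A.1 :=
    ((continuous_rayComplUnitary _).comp h₁).star.mul continuous_subtype_val
  exact (continuous_subtype_val.comp h₂).matrix_submatrix Sum.inr Sum.inr

theorem isSimplyConnected_firstColNe
    [SimplyConnectedSpace (unitary (Matrix ι ι (Quaternion ℝ)))] :
    IsSimplyConnected (firstColNe ι) :=
  SimplyConnectedSpace.of_retract continuous_unitaryChartSection
    (continuous_unitaryChart.subtype_mk unitaryChart_mem_firstColNe)
    fun A ↦ Subtype.ext (unitaryChart_unitaryChartSection A)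

/-- The complement of the line spanned by the basis vector `Pi.single i₀ 1`. -/
def lineCompl {k : Type*} [DecidableEq k] (i₀ : k) : Set (k → Quaternion ℝ) :=
  {w | ∀ r : ℝ, w ≠ r • Pi.single i₀ 1}

theorem isPathConnected_lineCompl {k : Type*} [Fintype k] [DecidableEq k] (i₀ : k) :
    IsPathConnected (lineCompl i₀) := by
  let L := Submodule.span ℝ {(Pi.single i₀ 1 : k → Quaternion ℝ)}
  have hL : lineCompl i₀ = (L : Set (k → Quaternion ℝ))ᶜ := by
    ext w
    simp [L, lineCompl, Submodule.mem_span_singleton, eq_comm]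
  rw [hL]
  refine isPathConnected_compl_of_one_lt_codim ?_
  rw [← Module.finrank_eq_rank, ← Nat.cast_one, Nat.cast_lt]
  have h₁ := Submodule.finrank_quotient_add_finrank L
  have h₂ : Module.finrank ℝ L = 1 := finrank_span_singleton (by simp)
  have h₃ := Module.finrank_pi_fintype ℝ (M := fun _ : k ↦ Quaternion ℝ)
  have h₄ : 0 < Fintype.card k := Fintype.card_pos_iff.2 ⟨i₀⟩
  rw [Finset.sum_const, Quaternion.finrank_eq_four, Finset.card_univ, smul_eq_mul] at h₃
  omega

theorem lineCompl_subset_rayCompl {k : Type*} [DecidableEq k] (i₀ : k) :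
    lineCompl i₀ ⊆ rayCompl i₀ :=
  fun _ hw r _ ↦ hw r

theorem vecNormalize_ne_neg_single {k : Type*} [Fintype k] [DecidableEq k] {i₀ : k}
    {w : k → Quaternion ℝ} (hw : w ∈ lineCompl i₀) : -vecNormalize w ≠ Pi.single i₀ 1 := by
  intro h
  refine hw (-√(vecNormSq w)) ?_
  rw [← h, neg_smul, smul_neg, neg_neg, sqrt_vecNormSq_smul_vecNormalize
    (ne_zero_of_mem_rayCompl (lineCompl_subset_rayCompl i₀ hw))]

theorem mem_lineCompl_of_vecNormSq_eq_one {k : Type*} [Fintype k] [DecidableEq k] {i₀ : k}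
    {v : k → Quaternion ℝ} (hv : vecNormSq v = 1) (h : v ≠ Pi.single i₀ 1)
    (h' : -v ≠ Pi.single i₀ 1) : v ∈ lineCompl i₀ := by
  rintro r rfl
  rw [vecNormSq_smul, vecNormSq_single, mul_one, sq_eq_one_iff] at hv
  obtain rfl | rfl := hv
  · exact h (one_smul _ _)
  · exact h' (by rw [neg_one_smul, neg_neg])

instance : ContinuousNeg (unitary (Matrix ι ι (Quaternion ℝ))) :=
  ⟨continuous_subtype_val.neg.subtype_mk _⟩

theorem image_unitaryChart_lineCompl :
    unitaryChart '' {p | p.1.1 ∈ lineCompl (Sum.inl () : Unit ⊕ ι)} =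
      firstColNe ι ∩ Neg.neg ⁻¹' firstColNe ι := by
  ext A
  constructor
  · rintro ⟨p, hp, rfl⟩
    refine ⟨unitaryChart_mem_firstColNe _, fun h ↦ vecNormalize_ne_neg_single hp ?_⟩
    rw [← h, ← col_unitaryChart]
    rfl
  · rintro ⟨hA, hA'⟩
    exact ⟨unitaryChartSection ⟨A, hA⟩, mem_lineCompl_of_vecNormSq_eq_one (vecNormSq_col A.2 _)
      hA hA', unitaryChart_unitaryChartSection ⟨A, hA⟩⟩

theorem isPathConnected_firstColNe_inter_neg
    [PathConnectedSpace (unitary (Matrix ι ι (Quaternion ℝ)))] :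
    IsPathConnected (firstColNe ι ∩ Neg.neg ⁻¹' firstColNe ι) := by
  rw [← image_unitaryChart_lineCompl]
  have h : IsPathConnected {w : rayCompl (Sum.inl () : Unit ⊕ ι) | w.1 ∈ lineCompl (Sum.inl ())} :=
    (isPathConnected_lineCompl _).preimage_coe (lineCompl_subset_rayCompl _)
  have h' : {p : rayCompl (Sum.inl () : Unit ⊕ ι) × unitary (Matrix ι ι (Quaternion ℝ)) |
      p.1.1 ∈ lineCompl (Sum.inl ())} = {w | w.1 ∈ lineCompl (Sum.inl ())} ×ˢ univ := by
    ext p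
    simp
  rw [h']
  exact (h.prod isPathConnected_univ).image continuous_unitaryChart

theorem simplyConnectedSpace_unitary_sum
    [SimplyConnectedSpace (unitary (Matrix ι ι (Quaternion ℝ)))] :
    SimplyConnectedSpace (unitary (Matrix (Unit ⊕ ι) (Unit ⊕ ι) (Quaternion ℝ))) := by
  refine simplyConnectedSpace_of_union isOpen_firstColNe
    (isOpen_firstColNe.preimage continuous_neg) ?_ isSimplyConnected_firstColNe
    ((Homeomorph.neg _).isSimplyConnected_preimage.2 isSimplyConnected_firstColNe)
    isPathConnected_firstColNe_inter_neg
  refine eq_univ_of_forall fun A ↦ (mem_union _ _ _).2 <| or_iff_not_imp_left.2 fun h h' ↦ ?_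
  have h : A.1.col (Sum.inl ()) = Pi.single (Sum.inl ()) 1 := not_not.1 h
  have h' : -A.1.col (Sum.inl ()) = Pi.single (Sum.inl ()) 1 := h'
  have h₀ := congrFun (h'.trans h.symm) (Sum.inl ())
  rw [Pi.neg_apply, h, Pi.single_eq_same] at h₀
  have := congrArg QuaternionAlgebra.re h₀
  rw [Quaternion.re_neg, Quaternion.re_one] at this
  norm_num at this

/-- Reindexing of unitary matrices. -/
noncomputable def unitaryReindex {m n : Type*} [Fintype m] [DecidableEq m] [Fintype n]
    [DecidableEq n] (e : m ≃ n) (A : unitary (Matrix n n (Quaternion ℝ))) :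
    unitary (Matrix m m (Quaternion ℝ)) :=
  ⟨A.1.submatrix e e, by
    rw [Unitary.mem_iff, star_eq_conjTranspose, conjTranspose_submatrix, submatrix_mul_equiv,
      submatrix_mul_equiv, ← star_eq_conjTranspose, Unitary.star_mul_self_of_mem A.2,
      Unitary.mul_star_self_of_mem A.2, submatrix_one_equiv]
    exact ⟨rfl, rfl⟩⟩

theorem continuous_unitaryReindex {m n : Type*} [Fintype m] [DecidableEq m] [Fintype n]
    [DecidableEq n] (e : m ≃ n) : Continuous (unitaryReindex e) :=
  (continuous_subtype_val.matrix_submatrix e e).subtype_mk _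

theorem simplyConnectedSpace_unitary_congr {m n : Type*} [Fintype m] [DecidableEq m] [Fintype n]
    [DecidableEq n] (e : m ≃ n) [SimplyConnectedSpace (unitary (Matrix m m (Quaternion ℝ)))] :
    SimplyConnectedSpace (unitary (Matrix n n (Quaternion ℝ))) :=
  SimplyConnectedSpace.of_retract (continuous_unitaryReindex e) (continuous_unitaryReindex e.symm)
    fun A ↦ Subtype.ext (by ext1 i j; simp [unitaryReindex])

end Stabilizer

/-- The compact symplectic groups are simply connected. -/
theorem simplyConnectedSpace_Sp (n : ℕ) : SimplyConnectedSpace (Sp n) := by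
  induction n with
  | zero => infer_instance
  | succ n ih =>
    have := simplyConnectedSpace_unitary_sum (ι := Fin n)
    exact simplyConnectedSpace_unitary_congr
      (((Equiv.sumComm Unit (Fin n)).trans
        ((Equiv.refl _).sumCongr (Equiv.ofUnique Unit (Fin 1)))).trans finSumFinEquiv)

/-- The compact symplectic group `Sp(4)` is simply connected. -/
theorem Sp4_simplyConnected : SimplyConnectedSpace (Sp 4) :=
  simplyConnectedSpace_Sp 4
end

section
/- The second homotopy group of the compact symplectic group Sp(4), based at the identity matrix, is trivial: π₂(Sp(4), 1) is a subsingleton. -/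
open scoped Topology

noncomputable section

namespace StarCayley

section Ring

variable {A : Type*} [Ring A]

/-- The Cayley transform `(1 - a) / (1 + a)`. -/
def cayley (a : A) : A := (1 - a) * Ring.inverse (1 + a)

theorem cayley_zero : cayley (0 : A) = 1 := by simp [cayley]

theorem cayley_one : cayley (1 : A) = 0 := by simp [cayley]

theorem commute_cayley_one_add (a : A) : Commute (1 - a) (Ring.inverse (1 + a)) := by
  have h : Commute (1 - a) (1 + a) :=
    (Commute.one_left _).sub_left ((Commute.one_right a).add_right (Commute.refl a))
  by_cases hu : IsUnit (1 + a)
  · obtain ⟨u, hu⟩ := hu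
    rw [← hu, Ring.inverse_unit]
    exact (show Commute (1 - a) (u : A) from hu ▸ h).units_inv_right
  · rw [Ring.inverse_non_unit _ hu]
    exact Commute.zero_right _

theorem one_add_mul_cayley {a : A} (h : IsUnit (1 + a)) : (1 + a) * cayley a = 1 - a := by
  rw [cayley, (commute_cayley_one_add a).eq, ← mul_assoc, Ring.mul_inverse_cancel _ h, one_mul]

theorem cayley_mul_one_add {a : A} (h : IsUnit (1 + a)) : cayley a * (1 + a) = 1 - a := by
  rw [cayley, mul_assoc, Ring.inverse_mul_cancel _ h, mul_one]

theorem eq_cayley_of_mul_eq {a b : A} (h : IsUnit (1 + a)) (hb : b * (1 + a) = 1 - a) :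
    b = cayley a :=
  h.mul_right_cancel (hb.trans (cayley_mul_one_add h).symm)

end Ring

section AlgebraReal

variable {A : Type*} [Ring A] [Algebra ℝ A]

theorem isUnit_one_add_cayley {k : A} (h : IsUnit (1 + k)) :
    IsUnit (1 + cayley k) := by
  have h1 : (1 + cayley k) * (1 + k) = (2 : ℝ) • (1 : A) := by
    rw [add_mul, cayley_mul_one_add h, two_smul]; noncomm_ring
  have h2 : IsUnit ((2 : ℝ) • (1 : A)) := by
    rw [← Algebra.algebraMap_eq_smul_one]
    exact (IsUnit.mk0 (2 : ℝ) two_ne_zero).map (algebraMap ℝ A)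
  obtain ⟨u, hu⟩ := h
  rw [← hu] at h1
  have := h2.mul u⁻¹.isUnit
  rwa [← h1, Units.mul_inv_cancel_right] at this

theorem cayley_cayley {a : A} (h : IsUnit (1 + a)) : cayley (cayley a) = a := by
  refine (eq_cayley_of_mul_eq (isUnit_one_add_cayley h) ?_).symm
  refine h.mul_right_cancel ?_
  have := cayley_mul_one_add h
  rw [mul_assoc, add_mul, sub_mul, this]
  noncomm_ring

end AlgebraReal

section StarRing

variable {A : Type*} [Ring A] [StarRing A]

theorem star_cayley {a : A} (ha : a ∈ unitary A) (h : IsUnit (1 + a)) :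
    star (cayley a) = -cayley a := by
  have hs : IsUnit (1 + star a) := by simpa using h.star
  rw [← neg_eq_iff_eq_neg]
  refine eq_cayley_of_mul_eq h ?_
  refine hs.mul_left_cancel ?_
  have h1 : (1 + star a) * star (cayley a) = 1 - star a := by
    simpa using congrArg star (cayley_mul_one_add h)
  have h2 : star a * a = 1 := Unitary.star_mul_self_of_mem ha
  calc (1 + star a) * (-star (cayley a) * (1 + a))
      = -((1 + star a) * star (cayley a)) * (1 + a) := by noncomm_ring
    _ = (1 + star a) * (1 - a) := by
      rw [h1]
      have : -(1 - star a) * (1 + a) - (1 + star a) * (1 - a) =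
          (2 : ℤ) • (star a * a) - (2 : ℤ) • 1 := by
        noncomm_ring
      rw [h2] at this
      rw [← sub_eq_zero, this, sub_self]

theorem cayley_mem_unitary {k : A} (hk : star k = -k) (h : IsUnit (1 + k)) :
    cayley k ∈ unitary A := by
  have hs : IsUnit (1 - k) := by simpa [hk, sub_eq_add_neg] using h.star
  have h1 : star (cayley k) * (1 - k) = 1 + k := by
    simpa [hk, sub_eq_add_neg] using congrArg star (one_add_mul_cayley h)
  have h2 : (1 - k) * star (cayley k) = 1 + k := by
    simpa [hk, sub_eq_add_neg] using congrArg star (cayley_mul_one_add h)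
  rw [Unitary.mem_iff]
  constructor
  · refine h.mul_right_cancel ?_
    rw [mul_assoc, cayley_mul_one_add h, h1, one_mul]
  · refine h.mul_left_cancel ?_
    rw [← mul_assoc, one_add_mul_cayley h, h2, mul_one]

end StarRing

section FiniteDimensional

variable {A : Type*} [Ring A] [Algebra ℝ A] [FiniteDimensional ℝ A]

theorem isUnit_of_mul_eq_zero_imp {a : A} (h : ∀ x, a * x = 0 → x = 0) : IsUnit a := by
  have hinj : Function.Injective (LinearMap.mulLeft ℝ a) := by
    rw [← LinearMap.ker_eq_bot, LinearMap.ker_eq_bot']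
    exact h
  obtain ⟨b, hb⟩ := LinearMap.injective_iff_surjective.1 hinj 1
  have hb : a * b = 1 := hb
  have hb' : b * a = 1 := by
    rw [← sub_eq_zero]
    refine h _ ?_
    rw [mul_sub, ← mul_assoc, hb, one_mul, mul_one, sub_self]
  exact ⟨⟨a, b, hb, hb'⟩, rfl⟩

theorem mul_eq_one_symm {a b : A} (h : a * b = 1) : b * a = 1 := by
  have hb : IsUnit b := isUnit_of_mul_eq_zero_imp fun x hx => by
    rw [← one_mul x, ← h, mul_assoc, hx, mul_zero]
  refine hb.mul_right_cancel ?_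
  rw [mul_assoc, h, mul_one, one_mul]

theorem isUnit_one_add_of_star_eq_neg [StarRing A] (hA : ∀ x : A, star x * x = 0 → x = 0)
    {k : A} (hk : star k = -k) : IsUnit (1 + k) := by
  refine isUnit_of_mul_eq_zero_imp fun x hx => hA x ?_
  have h1 : star x * x + star x * k * x = 0 := by
    have := congrArg (star x * ·) hx
    simpa [add_mul, mul_add, mul_assoc] using this
  have h2 : star x * x - star x * k * x = 0 := by
    have := congrArg star h1
    simpa [hk, mul_assoc, sub_eq_add_neg] using this
  have h3 : (2 : ℝ) • (star x * x) = 0 := by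
    rw [two_smul]
    calc _ = (star x * x + star x * k * x) + (star x * x - star x * k * x) := by abel
      _ = 0 := by rw [h1, h2, add_zero]
  exact (smul_eq_zero.1 h3).resolve_left two_ne_zero

end FiniteDimensional

section Contract

variable {A : Type*} [Ring A] [Algebra ℝ A]

/-- For `0 ≤ t ≤ 1`, this contracts the domain of the Cayley transform to `1`. -/
def contract (t : ℝ) (a : A) : A := cayley (t • cayley a)

theorem contract_zero (a : A) : contract 0 a = 1 := by simp [contract, cayley_zero]

theorem contract_one_right (t : ℝ) : contract t (1 : A) = 1 := by
  simp [contract, cayley_zero, cayley_one]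

theorem contract_one {a : A} (h : IsUnit (1 + a)) : contract 1 a = a := by
  simp [contract, cayley_cayley h]

variable [StarRing A] [StarModule ℝ A]

theorem star_smul_cayley {a : A} (ha : a ∈ unitary A) (h : IsUnit (1 + a)) (t : ℝ) :
    star (t • cayley a) = -(t • cayley a) := by
  rw [star_smul, star_cayley ha h]; simp

theorem contract_mem_unitary [FiniteDimensional ℝ A] (hA : ∀ x : A, star x * x = 0 → x = 0)
    {a : A} (ha : a ∈ unitary A) (h : IsUnit (1 + a)) (t : ℝ) : contract t a ∈ unitary A :=
  cayley_mem_unitary (star_smul_cayley ha h t)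
    (isUnit_one_add_of_star_eq_neg hA (star_smul_cayley ha h t))

end Contract

section Continuity

variable {A : Type*} [NormedRing A] [CompleteSpace A]

theorem continuousAt_cayley {a : A} (h : IsUnit (1 + a)) : ContinuousAt cayley a := by
  obtain ⟨u, hu⟩ := h
  have h1 : ContinuousAt (fun x : A => Ring.inverse (1 + x)) a :=
    ContinuousAt.comp (hu ▸ NormedRing.inverse_continuousAt u) (by fun_prop)
  exact ContinuousAt.mul (by fun_prop) h1

theorem continuous_contract [NormedAlgebra ℝ A] [FiniteDimensional ℝ A] [StarRing A]
    [StarModule ℝ A] (hA : ∀ x : A, star x * x = 0 → x = 0) {X : Type*} [TopologicalSpace X]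
    {t : X → ℝ} {a : X → A} (ht : Continuous t) (hc : Continuous a) (ha : ∀ x, a x ∈ unitary A)
    (h : ∀ x, IsUnit (1 + a x)) : Continuous fun x => contract (t x) (a x) := by
  rw [continuous_iff_continuousAt]
  intro x
  have h1 : ContinuousAt (fun x => t x • cayley (a x)) x :=
    ht.continuousAt.smul ((continuousAt_cayley (h x)).comp hc.continuousAt)
  exact ContinuousAt.comp (f := fun x => t x • cayley (a x)) (continuousAt_cayley
    (isUnit_one_add_of_star_eq_neg hA (star_smul_cayley (ha x) (h x) (t x)))) h1

end Continuity

section Polar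

variable {A : Type*} [NormedRing A] [NormedAlgebra ℝ A] [CompleteSpace A] [StarRing A]
  [ContinuousStar A]

/-- A `C¹` inverse square root near `1`, obtained from the inverse function theorem. -/
theorem exists_contDiffAt_inverse_sqrt : ∃ φ : A → A, φ 1 = 1 ∧ ∀ᶠ x in 𝓝 (1 : A),
    ContDiffAt ℝ 1 φ x ∧ (star x = x → star (φ x) * x * φ x = 1) := by
  let e : A ≃L[ℝ] A := ContinuousLinearEquiv.smulLeft (Units.mk0 (2 : ℝ) two_ne_zero)
  let f : A → A := fun x => x * x
  have hf : ContDiffAt ℝ 1 f 1 := contDiffAt_id.mul contDiffAt_id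
  have hf' : HasFDerivAt f (e : A →L[ℝ] A) 1 := by
    have := (hasFDerivAt_id (𝕜 := ℝ) (1 : A)).mul' (hasFDerivAt_id (1 : A))
    convert! this using 1
    ext x
    simp [e, two_smul, Units.smul_def]
  have hn : (1 : WithTop ℕ∞) ≠ 0 := one_ne_zero
  let S : A → A := hf.localInverse hf' hn
  have f1 : f 1 = 1 := one_mul 1
  have S1 : S 1 = 1 := by
    have := hf.localInverse_apply_image hf' hn
    rwa [f1] at this
  have hS : ContDiffAt ℝ 1 S 1 := by
    have := hf.to_localInverse hf' hn
    rwa [f1] at this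
  have hr : ∀ᶠ x in 𝓝 (1 : A), S x * S x = x := by
    have := (hf.hasStrictFDerivAt' hf' hn).eventually_right_inverse
    rwa [f1] at this
  have hl : ∀ᶠ x in 𝓝 (1 : A), S (x * x) = x :=
    (hf.hasStrictFDerivAt' hf' hn).eventually_left_inverse
  have hSt : Filter.Tendsto (fun x => star (S x)) (𝓝 1) (𝓝 1) := by
    have := hS.continuousAt.star
    rwa [ContinuousAt, S1, star_one] at this
  have hu : ∀ᶠ x in 𝓝 (1 : A), IsUnit (S x) := by
    have : Filter.Tendsto S (𝓝 1) (𝓝 1) := by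
      have := hS.continuousAt
      rwa [ContinuousAt, S1] at this
    exact this.eventually (Units.nhds (1 : Aˣ))
  refine ⟨fun x => Ring.inverse (S x), by simp [S1], ?_⟩
  filter_upwards [hS.eventually (by simp), hr, hSt.eventually hl, hu] with x h1 h2 h3 h4
  refine ⟨?_, fun hx => ?_⟩
  · obtain ⟨u, hu⟩ := h4
    exact ContDiffAt.comp x (hu ▸ contDiffAt_ringInverse ℝ u) h1
  · have h5 : star (S x) = S x := by
      rw [← star_mul, h2, hx] at h3
      exact h3.symm
    have h6 : star (Ring.inverse (S x)) = Ring.inverse (S x) := by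
      rw [← Ring.inverse_star, h5]
    rw [h6]
    nth_rewrite 2 [← h2]
    rw [← mul_assoc, Ring.inverse_mul_cancel _ h4, one_mul, Ring.mul_inverse_cancel _ h4]

/-- A map which is unitary-valued and `C¹` near the unitary group. -/
theorem exists_contDiffAt_unitarization [StarModule ℝ A] [FiniteDimensional ℝ A] :
    ∃ R : A → A, R 1 = 1 ∧ ∀ᶠ y in 𝓝 (1 : A), IsUnit (1 + R y) ∧ ∀ u ∈ unitary A,
      ContDiffAt ℝ 1 R (u * y) ∧ R (u * y) ∈ unitary A ∧ star u * R (u * y) = R y := by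
  obtain ⟨φ, h1, hφ⟩ := exists_contDiffAt_inverse_sqrt (A := A)
  have hφ1 : ContDiffAt ℝ 1 φ 1 := hφ.self_of_nhds.1
  have hq : ContDiff ℝ 1 fun x : A => star x * x :=
    (starL' ℝ : A ≃L[ℝ] A).contDiff.mul contDiff_id
  have hq1 : Filter.Tendsto (fun x : A => star x * x) (𝓝 1) (𝓝 1) := by
    have := hq.continuous.tendsto 1
    simpa using this
  have hR : ContinuousAt (fun x : A => x * φ (star x * x)) 1 := by
    refine continuousAt_id.mul (ContinuousAt.comp (g := φ) ?_ hq.continuous.continuousAt)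
    simpa using hφ1.continuousAt
  have hU : ∀ᶠ y in 𝓝 (1 : A), IsUnit (1 + y * φ (star y * y)) := by
    have h2 : IsUnit (1 + (1 : A)) := by
      have := isUnit_one_add_cayley (A := A) (k := 0) (by simp)
      rwa [cayley_zero] at this
    have h3 : ContinuousAt (fun x : A => 1 + x * φ (star x * x)) 1 := continuousAt_const.add hR
    refine h3.eventually ?_
    obtain ⟨w, hw⟩ := h2
    simp only [star_one, mul_one, h1]
    rw [← hw]
    exact Units.nhds w
  refine ⟨fun x => x * φ (star x * x), by simp [h1], ?_⟩
  filter_upwards [hq1.eventually hφ, hU] with y hy hy'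
  refine ⟨hy', fun u hu => ?_⟩
  have huu : star u * u = 1 := Unitary.star_mul_self_of_mem hu
  have e1 : star (u * y) * (u * y) = star y * y := by
    rw [star_mul, mul_assoc, ← mul_assoc (star u), huu, one_mul]
  refine ⟨?_, ?_, ?_⟩
  · refine contDiffAt_id.mul (ContDiffAt.comp (g := φ) (u * y) ?_ hq.contDiffAt)
    rw [e1]
    exact hy.1
  · have h2 := hy.2 (by simp)
    simp only [e1]
    have h3 : star (u * y * φ (star y * y)) * (u * y * φ (star y * y)) = 1 := by
      rw [star_mul, mul_assoc, ← mul_assoc (star (u * y)), e1, ← mul_assoc, h2]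
    exact Unitary.mem_iff.2 ⟨h3, mul_eq_one_symm h3⟩
  · simp only [e1]
    rw [← mul_assoc, ← mul_assoc, huu, one_mul]

end Polar

section HomotopyGroup

variable {A : Type*} [NormedRing A] [NormedAlgebra ℝ A] [FiniteDimensional ℝ A]
  [CompleteSpace A] [StarRing A] [ContinuousStar A] [StarModule ℝ A] {N : Type*} [Fintype N]

open scoped unitInterval Topology.Homotopy

/-- A generalized loop in the unitary group is close to a `C¹` one. -/
theorem exists_contDiff_unitary_near (f : Ω^ N (unitary A) 1) :
    ∃ g : (N → ℝ) → A, ContDiff ℝ 1 g ∧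
      (∀ x : I^N, g (fun i => x i) ∈ unitary A ∧
        IsUnit (1 + star (f x : A) * g (fun i => x i))) ∧
      ∀ x ∈ Cube.boundary N, g (fun i => x i) = 1 := by
  obtain ⟨R, R1, hR⟩ := exists_contDiffAt_unitarization (A := A)
  obtain ⟨δ, hδ, hR⟩ := Metric.eventually_nhds_iff.1 hR
  have hfc : Continuous fun x => (f x : A) := continuous_subtype_val.comp f.1.continuous
  obtain ⟨c, hc⟩ := isCompact_univ.exists_bound_of_continuousOn hfc.star.continuousOn
  have hc : ∀ x, ‖star (f x : A)‖ ≤ c := fun x => hc x (Set.mem_univ x)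
  have hc0 : 0 ≤ c := (norm_nonneg _).trans (hc 0)
  let ε : ℝ := δ / (3 * (c + 1))
  have hε : 0 < ε := by positivity
  have hεδ : c * (3 * ε) < δ := by
    have : (c + 1) * (3 * ε) = δ := by simp only [ε]; field_simp
    nlinarith
  let P : (N → ℝ) → (I^N) := fun y i => Set.projIcc 0 1 zero_le_one (y i)
  have hP : Continuous P := by
    refine continuous_pi fun i => continuous_projIcc.comp (continuous_apply i)
  have hPx : ∀ x : I^N, P (fun i => x i) = x := fun x => by
    funext i; exact Set.projIcc_val zero_le_one (x i)
  have hF : Continuous fun y => (f (P y) : A) - 1 := (hfc.comp hP).sub continuous_const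
  obtain ⟨h, hh, hhF, -⟩ := hF.exists_contDiff_approx (ε := fun _ => ε) 1 continuous_const
    fun _ => hε
  let β : ContDiffBump (0 : A) := ⟨ε, 2 * ε, hε, by linarith⟩
  let T : (N → ℝ) → A := fun y => 1 + (1 - β (h y)) • h y
  have hT : ContDiff ℝ 1 T :=
    contDiff_const.add ((contDiff_const.sub (β.contDiff.comp hh)).smul hh)
  have hTf : ∀ y, ‖T y - f (P y)‖ < 3 * ε := fun y => by
    have h1 : ‖h y - (f (P y) - 1)‖ < ε := by simpa [dist_eq_norm] using hhF y
    have h2 : ‖β (h y) • h y‖ ≤ 2 * ε := by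
      rcases le_or_gt (2 * ε) ‖h y‖ with h3 | h3
      · rw [β.zero_of_le_dist (by simpa using h3)]; simp [hε.le]
      · rw [norm_smul, Real.norm_of_nonneg β.nonneg]
        nlinarith [β.le_one (x := h y), norm_nonneg (h y)]
    calc ‖T y - f (P y)‖ = ‖(h y - (f (P y) - 1)) - β (h y) • h y‖ := by
          congr 1; simp only [T, sub_smul, one_smul]; abel
      _ ≤ ‖h y - (f (P y) - 1)‖ + ‖β (h y) • h y‖ := norm_sub_le _ _
      _ < 3 * ε := by linarith
  have hY : ∀ y, dist (star (f (P y) : A) * T y) 1 < δ := fun y => by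
    have h1 : star (f (P y) : A) * T y - 1 = star (f (P y) : A) * (T y - f (P y)) := by
      rw [mul_sub, Unitary.star_mul_self_of_mem (f (P y)).2]
    rw [dist_eq_norm, h1]
    calc _ ≤ ‖star (f (P y) : A)‖ * ‖T y - f (P y)‖ := norm_mul_le _ _
      _ ≤ c * (3 * ε) := mul_le_mul (hc _) (hTf y).le (norm_nonneg _) hc0
      _ < δ := hεδ
  have hTY : ∀ y, (f (P y) : A) * (star (f (P y) : A) * T y) = T y := fun y => by
    rw [← mul_assoc, Unitary.mul_star_self_of_mem (f (P y)).2, one_mul]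
  have key : ∀ y, ContDiffAt ℝ 1 R (T y) ∧ R (T y) ∈ unitary A ∧
      IsUnit (1 + star (f (P y) : A) * R (T y)) := fun y => by
    obtain ⟨h1, h2⟩ := hR (hY y)
    obtain ⟨h3, h4, h5⟩ := h2 _ (f (P y)).2
    rw [hTY] at h3 h4 h5
    exact ⟨h3, h4, h5 ▸ h1⟩
  refine ⟨fun y => R (T y), ?_, fun x => ?_, fun x hx => ?_⟩
  · exact contDiff_iff_contDiffAt.2 fun y => (key y).1.comp y hT.contDiffAt
  · have := (key fun i => x i).2
    rwa [hPx] at this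
  · have h1 : ‖h fun i => x i‖ < ε := by
      have := hhF fun i => x i
      rw [hPx, show f x = 1 from f.2 x hx] at this
      simpa using this
    have h2 : β (h fun i => x i) = 1 := β.one_of_mem_closedBall (by simpa using h1.le)
    simp [T, h2, R1]

/-- If generic unitary translates of `C¹` maps take values in the domain of the Cayley transform,
then the homotopy group of the unitary group is trivial. -/
theorem subsingleton_homotopyGroup_unitary (hA : ∀ x : A, star x * x = 0 → x = 0)
    (hgen : ∀ g : (N → ℝ) → A, ContDiff ℝ 1 g →
      ∃ k : A, star k = -k ∧ ∀ x, IsUnit ((1 + k) + (1 - k) * g x)) :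
    Subsingleton (HomotopyGroup N (unitary A) 1) := by
  suffices h : ∀ f : Ω^ N (unitary A) 1, GenLoop.Homotopic f GenLoop.const by
    refine ⟨fun a b => ?_⟩
    induction a using Quotient.inductionOn with | _ a =>
    induction b using Quotient.inductionOn with | _ b =>
    exact Quotient.sound ((h a).trans (h b).symm)
  intro f
  obtain ⟨g, hg, hgf, hgb⟩ := exists_contDiff_unitary_near f
  obtain ⟨k, hk, hkg⟩ := hgen g hg
  have hku : IsUnit (1 + k) := isUnit_one_add_of_star_eq_neg hA hk
  let v := cayley k
  have hv : v ∈ unitary A := cayley_mem_unitary hk hku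
  have hv1 : IsUnit (1 + v) := isUnit_one_add_cayley hku
  have hvg : ∀ y, IsUnit (1 + v * g y) := fun y => by
    have h1 : (1 + k) * (1 + v * g y) = (1 + k) + (1 - k) * g y := by
      rw [mul_add, mul_one, ← mul_assoc, one_add_mul_cayley hku]
    obtain ⟨u, hu⟩ := hku
    have := u⁻¹.isUnit.mul (hkg y)
    rwa [← h1, ← hu, Units.inv_mul_cancel_left] at this
  let γ : (I^N) → A := fun x => g fun i => x i
  have hγ : Continuous γ := hg.continuous.comp (by fun_prop)
  have hfc : Continuous fun x => (f x : A) := continuous_subtype_val.comp f.1.continuous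
  have hvγ : ∀ x, v * γ x ∈ unitary A := fun x => mul_mem hv (hgf x).1
  have hfγ : ∀ x, star (f x : A) * γ x ∈ unitary A := fun x =>
    mul_mem (Unitary.star_mem (f x).2) (hgf x).1
  let a : I × (I^N) → unitary A := fun p =>
    ⟨contract (1 - p.1) v, contract_mem_unitary hA hv hv1 _⟩
  let b : I × (I^N) → unitary A := fun p =>
    ⟨contract (1 - p.1) (v * γ p.2), contract_mem_unitary hA (hvγ _) (hvg _) _⟩
  let d : I × (I^N) → unitary A := fun p =>
    ⟨contract (1 - p.1) (star (f p.2 : A) * γ p.2),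
      contract_mem_unitary hA (hfγ _) (hgf _).2 _⟩
  have ht : Continuous fun p : I × (I^N) => 1 - (p.1 : ℝ) := by fun_prop
  have ha : Continuous a := Continuous.subtype_mk
    (continuous_contract hA ht continuous_const (fun _ => hv) fun _ => hv1) _
  have hb : Continuous b := Continuous.subtype_mk
    (continuous_contract hA ht (continuous_const.mul (hγ.comp continuous_snd)) (fun _ => hvγ _)
      fun _ => hvg _) _
  have hd : Continuous d := Continuous.subtype_mk
    (continuous_contract hA ht ((hfc.star.mul hγ).comp continuous_snd) (fun _ => hfγ _)
      fun p => (hgf p.2).2) _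
  refine ⟨⟨⟨⟨fun p => (a p)⁻¹ * b p * (d p)⁻¹, by fun_prop⟩, fun x => ?_, fun x => ?_⟩, ?_⟩⟩
  · change (a (0, x))⁻¹ * b (0, x) * (d (0, x))⁻¹ = f x
    have e1 : a (0, x) = ⟨v, hv⟩ := Subtype.ext (by simp [a, contract_one hv1])
    have e2 : b (0, x) = ⟨v, hv⟩ * ⟨γ x, (hgf x).1⟩ :=
      Subtype.ext (by simp [b, contract_one (hvg _), γ])
    have e3 : d (0, x) = (f x)⁻¹ * ⟨γ x, (hgf x).1⟩ :=
      Subtype.ext (by simp only [d, Set.Icc.coe_zero, sub_zero, contract_one (hgf x).2, γ]; rfl)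
    rw [e1, e2, e3]
    group
  · change (a (1, x))⁻¹ * b (1, x) * (d (1, x))⁻¹ = 1
    have e1 : a (1, x) = 1 := Subtype.ext (by simp [a, contract_zero])
    have e2 : b (1, x) = 1 := Subtype.ext (by simp [b, contract_zero])
    have e3 : d (1, x) = 1 := Subtype.ext (by simp [d, contract_zero])
    simp [e1, e2, e3]
  · intro t x hx
    change (a (t, x))⁻¹ * b (t, x) * (d (t, x))⁻¹ = f x
    have hγx : γ x = 1 := hgb x hx
    have hfx : f x = 1 := f.2 x hx
    have e2 : b (t, x) = a (t, x) := Subtype.ext (by simp [a, b, hγx])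
    have e3 : d (t, x) = 1 := Subtype.ext (by simp [d, hγx, hfx, contract_one_right])
    simp [e2, e3, hfx]

end HomotopyGroup

section Quaternion

open scoped Quaternion Matrix

instance : StarModule ℝ ℍ[ℝ] := ⟨fun r q => Quaternion.star_smul r q⟩

theorem contDiff_star_quaternion : ContDiff ℝ 1 (star : ℍ[ℝ] → ℍ[ℝ]) :=
  (starL' ℝ : ℍ[ℝ] ≃L[ℝ] ℍ[ℝ]).contDiff

theorem contDiffAt_inv_quaternion {q : ℍ[ℝ]} (hq : q ≠ 0) :
    ContDiffAt ℝ 1 (fun x : ℍ[ℝ] => x⁻¹) q := by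
  have h := contDiffAt_ringInverse (n := 1) ℝ (Units.mk0 q hq)
  rwa [Ring.inverse_eq_inv'] at h

theorem matrix_eq_zero_of_star_mul_self {ι : Type*} [Fintype ι]
    {x : Matrix ι ι ℍ[ℝ]} (hx : star x * x = 0) : x = 0 := by
  ext1 a b
  have h : ∑ c, Quaternion.normSq (x c b) = 0 := by
    have h1 : (star x * x) b b = ((∑ c, Quaternion.normSq (x c b) : ℝ) : ℍ[ℝ]) := by
      simp only [Matrix.star_eq_conjTranspose, Matrix.mul_apply, Matrix.conjTranspose_apply,
        Quaternion.star_mul_self]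
      exact (map_sum (algebraMap ℝ ℍ[ℝ]) _ _).symm
    rw [hx, Matrix.zero_apply] at h1
    exact Quaternion.coe_injective (h1.symm.trans Quaternion.coe_zero.symm)
  have := (Finset.sum_eq_zero_iff_of_nonneg fun c _ => Quaternion.normSq_nonneg).1 h a
    (Finset.mem_univ a)
  exact Quaternion.normSq_eq_zero.1 this

variable {m : ℕ}

/-- Parameters for the pairs `(M, x)` with `(1 + K) + (1 - K) * g x` singular, `K = M - Mᴴ`: the
point `x`, a normalized kernel vector without its coordinate equal to `1`, the matrix `M` without
one column, and the real part of the diagonal entry of the missing column. -/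
abbrev SingularParam (m : ℕ) : Type :=
  (Fin 2 → ℝ) × (Fin m → ℍ[ℝ]) × (Fin (m + 1) → Fin m → ℍ[ℝ]) × ℝ

variable (g : (Fin 2 → ℝ) → Fin (m + 1) → Fin (m + 1) → ℍ[ℝ]) (i j : Fin (m + 1))

/-- The kernel vector `p`. -/
def kernelVec (e : SingularParam m) (a : Fin (m + 1)) : ℍ[ℝ] :=
  i.insertNth (α := fun _ => ℍ[ℝ]) 1 e.2.1 a

/-- The vector `g x p - p`. -/
def sourceVec (e : SingularParam m) (a : Fin (m + 1)) : ℍ[ℝ] :=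
  ∑ b, g e.1 a b * kernelVec i e b - kernelVec i e a

/-- The vector `p + g x p`, which must be the image of `g x p - p` under `K`. -/
def targetVec (e : SingularParam m) (a : Fin (m + 1)) : ℍ[ℝ] :=
  kernelVec i e a + ∑ b, g e.1 a b * kernelVec i e b

/-- The off-diagonal entries of the `j`-th column of `K`. -/
def skewColumn (e : SingularParam m) (b : Fin m) : ℍ[ℝ] :=
  (targetVec g i e (j.succAbove b) - ∑ l, (e.2.2.1 (j.succAbove b) l -
    star (e.2.2.1 (j.succAbove l) b)) * sourceVec g i e (j.succAbove l)) * (sourceVec g i e j)⁻¹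

/-- The `j`-th diagonal entry of `K`. -/
def skewDiagonal (e : SingularParam m) : ℍ[ℝ] :=
  (targetVec g i e j + ∑ l, star (skewColumn g i j e l) * sourceVec g i e (j.succAbove l)) *
    (sourceVec g i e j)⁻¹

/-- The matrix `M` recovered from its parameters. -/
def singularMatrix (e : SingularParam m) (a b : Fin (m + 1)) : ℍ[ℝ] :=
  j.insertNth (α := fun _ => ℍ[ℝ])
    (j.insertNth (α := fun _ => ℍ[ℝ]) ((e.2.2.2 : ℍ[ℝ]) + (2⁻¹ : ℝ) • skewDiagonal g i j e)
      (fun c => skewColumn g i j e c + star (e.2.2.1 j c)) a) (e.2.2.1 a) b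

variable {g}

theorem contDiff_kernelVec (a : Fin (m + 1)) : ContDiff ℝ 1 fun e => kernelVec i e a := by
  cases a using Fin.succAboveCases i with
  | x => simpa [kernelVec] using contDiff_const
  | p b => simp only [kernelVec, Fin.insertNth_apply_succAbove]; fun_prop

theorem contDiff_mulVec_kernelVec (hg : ∀ a b, ContDiff ℝ 1 fun x => g x a b)
    (a : Fin (m + 1)) : ContDiff ℝ 1 fun e => ∑ b, g e.1 a b * kernelVec i e b :=
  ContDiff.sum fun b _ => ((hg a b).comp contDiff_fst).mul (contDiff_kernelVec i b)

theorem contDiff_sourceVec (hg : ∀ a b, ContDiff ℝ 1 fun x => g x a b) (a : Fin (m + 1)) :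
    ContDiff ℝ 1 fun e => sourceVec g i e a :=
  (contDiff_mulVec_kernelVec i hg a).sub (contDiff_kernelVec i a)

theorem contDiff_targetVec (hg : ∀ a b, ContDiff ℝ 1 fun x => g x a b) (a : Fin (m + 1)) :
    ContDiff ℝ 1 fun e => targetVec g i e a :=
  (contDiff_kernelVec i a).add (contDiff_mulVec_kernelVec i hg a)

theorem contDiffAt_skewColumn (hg : ∀ a b, ContDiff ℝ 1 fun x => g x a b) {e : SingularParam m}
    (he : sourceVec g i e j ≠ 0) (b : Fin m) :
    ContDiffAt ℝ 1 (fun e => skewColumn g i j e b) e := by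
  refine ContDiffAt.mul (ContDiffAt.sub (contDiff_targetVec i hg _).contDiffAt
    (ContDiffAt.sum fun l _ => ContDiffAt.mul (ContDiffAt.sub (by fun_prop) ?_)
      (contDiff_sourceVec i hg _).contDiffAt)) ?_
  · exact contDiff_star_quaternion.contDiffAt.comp e (by fun_prop)
  · exact (contDiffAt_inv_quaternion he).comp e (contDiff_sourceVec i hg j).contDiffAt

theorem contDiffAt_skewDiagonal (hg : ∀ a b, ContDiff ℝ 1 fun x => g x a b)
    {e : SingularParam m} (he : sourceVec g i e j ≠ 0) :
    ContDiffAt ℝ 1 (fun e => skewDiagonal g i j e) e :=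
  ContDiffAt.mul (ContDiffAt.add (contDiff_targetVec i hg _).contDiffAt
    (ContDiffAt.sum fun l _ => ContDiffAt.mul
      (contDiff_star_quaternion.contDiffAt.comp e (contDiffAt_skewColumn i j hg he l))
      (contDiff_sourceVec i hg _).contDiffAt))
    ((contDiffAt_inv_quaternion he).comp e (contDiff_sourceVec i hg j).contDiffAt)

theorem contDiffAt_singularMatrix (hg : ∀ a b, ContDiff ℝ 1 fun x => g x a b)
    {e : SingularParam m} (he : sourceVec g i e j ≠ 0) :
    ContDiffAt ℝ 1 (singularMatrix g i j) e := by
  refine contDiffAt_pi.2 fun a => contDiffAt_pi.2 fun b => ?_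
  cases b using Fin.succAboveCases j with
  | x =>
    cases a using Fin.succAboveCases j with
    | x =>
      simp only [singularMatrix, Fin.insertNth_apply_same]
      refine ContDiffAt.add ?_ ((contDiffAt_skewDiagonal i j hg he).const_smul (2⁻¹ : ℝ))
      have h : ContDiff ℝ 1 fun t : ℝ => (t : ℍ[ℝ]) :=
        (Algebra.linearMap ℝ ℍ[ℝ]).toContinuousLinearMap.contDiff
      exact h.contDiffAt.comp e (by fun_prop)
    | p c =>
      simp only [singularMatrix, Fin.insertNth_apply_same, Fin.insertNth_apply_succAbove]
      exact (contDiffAt_skewColumn i j hg he c).add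
        (contDiff_star_quaternion.contDiffAt.comp e (by fun_prop))
  | p l => simp only [singularMatrix, Fin.insertNth_apply_succAbove]; fun_prop

theorem dimH_image_singularMatrix_le (hg : ∀ a b, ContDiff ℝ 1 fun x => g x a b) :
    dimH (singularMatrix g i j '' {e | sourceVec g i e j ≠ 0}) ≤
      ((2 + (m * 4 + ((m + 1) * (m * 4) + 1)) : ℕ) : ENNReal) := by
  refine (dimH_image_le_of_locally_lipschitzOn fun e he => ?_).trans
    ((dimH_mono (Set.subset_univ _)).trans ?_)
  · obtain ⟨C, t, ht, hC⟩ := (contDiffAt_singularMatrix i j hg he).exists_lipschitzOnWith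
    exact ⟨C, t, mem_nhdsWithin_of_mem_nhds ht, hC⟩
  · rw [Real.dimH_univ_eq_finrank]
    simp [Module.finrank_prod, Module.finrank_pi_fintype, Quaternion.finrank_eq_four]

/-- A matrix `M` with skew part `K` satisfying `K (g x p - p) = p + g x p` is determined by its
parameters. -/
theorem eq_singularMatrix {M : Matrix (Fin (m + 1)) (Fin (m + 1)) ℍ[ℝ]} {x : Fin 2 → ℝ}
    {p : Fin (m + 1) → ℍ[ℝ]} (hp : p i = 1)
    (hK : ∀ a, ∑ b, (M a b - star (M b a)) * (∑ c, g x b c * p c - p b) =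
      p a + ∑ c, g x a c * p c) (hr : ∑ c, g x j c * p c - p j ≠ 0) :
    ∃ e, sourceVec g i e j ≠ 0 ∧ singularMatrix g i j e = M := by
  let e : SingularParam m :=
    (x, fun b => p (i.succAbove b), fun a l => M a (j.succAbove l), (M j j).re)
  have hpe : kernelVec i e = p := by
    funext a
    cases a using Fin.succAboveCases i with
    | x => simp [kernelVec, hp]
    | p b => simp [kernelVec, e]
  have hs : ∀ a, sourceVec g i e a = ∑ c, g x a c * p c - p a := fun a => by
    simp [sourceVec, hpe, e]
  have ht : ∀ a, targetVec g i e a = p a + ∑ c, g x a c * p c := fun a => by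
    simp [targetVec, hpe, e]
  have hK' : ∀ a, (M a j - star (M j a)) * sourceVec g i e j +
      ∑ l, (M a (j.succAbove l) - star (M (j.succAbove l) a)) * sourceVec g i e (j.succAbove l) =
      targetVec g i e a := fun a => by
    rw [ht, ← hK a, Fin.sum_univ_succAbove _ j]
    simp only [hs]
  have hr' : sourceVec g i e j ≠ 0 := by rwa [hs]
  have hcol : ∀ b, skewColumn g i j e b = M (j.succAbove b) j - star (M j (j.succAbove b)) := by
    intro b
    rw [skewColumn, ← hK', mul_inv_eq_iff_eq_mul₀ hr']
    simp [e]
  have hdiag : skewDiagonal g i j e = M j j - star (M j j) := by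
    rw [skewDiagonal, ← hK', mul_inv_eq_iff_eq_mul₀ hr', add_assoc, ← Finset.sum_add_distrib,
      add_eq_left]
    refine Finset.sum_eq_zero fun l _ => ?_
    rw [hcol, star_sub, star_star]
    noncomm_ring
  refine ⟨e, hr', ?_⟩
  funext a b
  cases b using Fin.succAboveCases j with
  | x =>
    cases a using Fin.succAboveCases j with
    | x =>
      simp only [singularMatrix, Fin.insertNth_apply_same, hdiag, e]
      ext <;> simp <;> ring
    | p c => simp [singularMatrix, hcol, e]
  | p l => simp [singularMatrix, e]

/-- For a `C¹` map `g` from the plane to quaternionic matrices there is a skew-Hermitian `k` such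
that `(1 + k) + (1 - k) * g x` is invertible for all `x`. -/
theorem exists_skew_forall_isUnit {g : (Fin 2 → ℝ) → Matrix (Fin (m + 1)) (Fin (m + 1)) ℍ[ℝ]}
    (hg : ∀ a b, ContDiff ℝ 1 fun x => g x a b) :
    ∃ k : Matrix (Fin (m + 1)) (Fin (m + 1)) ℍ[ℝ],
      star k = -k ∧ ∀ x, IsUnit ((1 + k) + (1 - k) * g x) := by
  let B : Set (Fin (m + 1) → Fin (m + 1) → ℍ[ℝ]) :=
    ⋃ i, ⋃ j, singularMatrix g i j '' {e | sourceVec g i e j ≠ 0}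
  have hB : dimH B < Module.finrank ℝ (Fin (m + 1) → Fin (m + 1) → ℍ[ℝ]) := by
    have h1 : dimH B ≤ ((2 + (m * 4 + ((m + 1) * (m * 4) + 1)) : ℕ) : ENNReal) := by
      simp only [B, dimH_iUnion]
      exact iSup_le fun i => iSup_le fun j => dimH_image_singularMatrix_le i j hg
    refine h1.trans_lt (Nat.cast_lt.2 ?_)
    simp only [Module.finrank_pi_fintype, Quaternion.finrank_eq_four, Finset.sum_const,
      Finset.card_univ, Fintype.card_fin, smul_eq_mul]
    nlinarith
  obtain ⟨M, hM⟩ := (dense_compl_of_dimH_lt_finrank hB).nonempty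
  let M : Matrix (Fin (m + 1)) (Fin (m + 1)) ℍ[ℝ] := M
  refine ⟨M - star M, by simp, fun x => ?_⟩
  by_contra hx
  apply hM
  obtain ⟨X, hX, hX0⟩ : ∃ X, ((1 + (M - star M)) + (1 - (M - star M)) * g x) * X = 0 ∧ X ≠ 0 := by
    by_contra! h
    exact hx (isUnit_of_mul_eq_zero_imp h)
  obtain ⟨i, b, hib⟩ : ∃ i b, X i b ≠ 0 := by
    by_contra! h
    exact hX0 (Matrix.ext h)
  let p : Fin (m + 1) → ℍ[ℝ] := fun a => X a b * (X i b)⁻¹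
  have hp : p i = 1 := mul_inv_cancel₀ hib
  have hXp : ((1 + (M - star M)) + (1 - (M - star M)) * g x) *ᵥ p = 0 := by
    funext a
    have := congrFun (congrFun hX a) b
    simp only [Matrix.mul_apply, Matrix.zero_apply] at this
    simp only [Matrix.mulVec, dotProduct, p, ← mul_assoc, ← Finset.sum_mul, this, zero_mul,
      Pi.zero_apply]
  have hK : (M - star M) *ᵥ (g x *ᵥ p - p) = p + g x *ᵥ p := by
    rw [Matrix.add_mulVec, Matrix.add_mulVec, Matrix.one_mulVec, ← Matrix.mulVec_mulVec,
      Matrix.sub_mulVec 1 (M - star M), Matrix.one_mulVec] at hXp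
    rw [Matrix.mulVec_sub, ← sub_eq_zero, ← neg_eq_zero, ← hXp]
    abel
  obtain ⟨j, hj⟩ : ∃ j, (g x *ᵥ p - p) j ≠ 0 := by
    by_contra! h
    have h0 : g x *ᵥ p - p = 0 := funext h
    rw [h0, Matrix.mulVec_zero, sub_eq_zero.1 h0] at hK
    have h1 := congrFun hK i
    simp only [Pi.zero_apply, Pi.add_apply, hp] at h1
    have h2 := congrArg QuaternionAlgebra.re h1
    rw [Quaternion.re_zero, Quaternion.re_add, Quaternion.re_one] at h2
    norm_num at h2
  obtain ⟨e, he, heM⟩ := eq_singularMatrix (g := g) (M := M) (x := x) i j hp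
    (fun a => congrFun hK a) hj
  exact Set.mem_iUnion.2 ⟨i, Set.mem_iUnion.2 ⟨j, e, he, heM⟩⟩

end Quaternion

open scoped Matrix.Norms.Operator in
theorem subsingleton_pi_two_Sp (m : ℕ) : Subsingleton (π_ 2 (Sp (m + 1)) 1) := by
  have : @ContinuousStar (Matrix (Fin (m + 1)) (Fin (m + 1)) (Quaternion ℝ))
      (Matrix.linftyOpNormedRing
        (α := Quaternion ℝ)).toPseudoMetricSpace.toUniformSpace.toTopologicalSpace _ :=
    inferInstanceAs (ContinuousStar (Matrix (Fin (m + 1)) (Fin (m + 1)) (Quaternion ℝ)))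
  refine subsingleton_homotopyGroup_unitary
    (A := Matrix (Fin (m + 1)) (Fin (m + 1)) (Quaternion ℝ)) (N := Fin 2)
    (fun x hx => matrix_eq_zero_of_star_mul_self hx) fun g hg =>
      exists_skew_forall_isUnit fun a b => ?_
  exact (Matrix.entryLinearMap ℝ (Quaternion ℝ) a b).toContinuousLinearMap.contDiff.comp hg

end StarCayley

end

/-- The second homotopy group of `Sp(4)` based at the identity is trivial:
`π₂(Sp(4), 1)` is a subsingleton. -/
theorem pi2_Sp4_trivial : Subsingleton (π_ 2 (Sp 4) 1) := by
  exact StarCayley.subsingleton_pi_two_Sp 3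
end

section
/- The second homotopy group of the special unitary group SU(8), based at the identity matrix, is trivial: π₂(SU(8), 1) is a subsingleton. -/
open scoped Topology

open Matrix ContDiff Manifold

section UnitaryRotation

variable {ι : Type*}

/-- The rank-one matrix `v w*` of two vectors of a Euclidean space. -/
def outer (v w : EuclideanSpace ℂ ι) : Matrix ι ι ℂ :=
  vecMulVec v.ofLp (star w.ofLp)

lemma outer_mulVec [Fintype ι] (v w x : EuclideanSpace ℂ ι) :
    outer v w *ᵥ x.ofLp = (inner ℂ w x • v).ofLp := by
  ext i
  simp [outer, vecMulVec_mulVec, EuclideanSpace.inner_eq_star_dotProduct, dotProduct_comm, mul_comm]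

lemma outer_mul_outer [Fintype ι] (v w x y : EuclideanSpace ℂ ι) :
    outer v w * outer x y = inner ℂ w x • outer v y := by
  simp [outer, vecMulVec_mul_vecMulVec, EuclideanSpace.inner_eq_star_dotProduct, dotProduct_comm,
    vecMulVec_smul]

lemma star_outer (v w : EuclideanSpace ℂ ι) : star (outer v w) = outer w v := by
  ext i j
  simp [outer, vecMulVec_apply, mul_comm]

lemma continuous_outer {X : Type*} [TopologicalSpace X] {v w : X → EuclideanSpace ℂ ι}
    (hv : Continuous v) (hw : Continuous w) : Continuous fun x => outer (v x) (w x) := by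
  unfold outer
  exact Continuous.matrix_vecMulVec (by fun_prop) (by fun_prop)

variable [Fintype ι] {v w : EuclideanSpace ℂ ι}

lemma inner_self_of_norm_eq_one (hv : ‖v‖ = 1) : inner ℂ v v = 1 := by
  rw [inner_self_eq_norm_sq_to_K, hv]; simp

lemma inner_add_self_ne_zero (hv : ‖v‖ = 1) (hw : ‖w‖ = 1) (h : v ≠ -w) :
    inner ℂ (v + w) v ≠ 0 := by
  intro h0
  have h1 : inner ℂ v (v + w) = 0 := by rw [← inner_conj_symm, h0, map_zero]
  rw [inner_add_left, inner_self_of_norm_eq_one hv] at h0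
  rw [inner_add_right, inner_self_of_norm_eq_one hv] at h1
  have : inner ℂ (v + w) (v + w) = 0 := by
    rw [inner_add_left, inner_add_right, inner_add_right, inner_self_of_norm_eq_one hv,
      inner_self_of_norm_eq_one hw]
    linear_combination h0 + h1
  exact h (eq_neg_of_add_eq_zero_left (inner_self_eq_zero.mp this))

variable [DecidableEq ι]

/-- For unit vectors `v ≠ -w`, a unitary matrix carrying `v` to `w`, the product of two complex
reflections; it is the identity on the orthogonal complement of `v` and `w`. -/
noncomputable def unitaryRotation (v w : EuclideanSpace ℂ ι) : Matrix ι ι ℂ :=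
  (1 - (inner ℂ (v + w) v)⁻¹ • outer (v + w) (v + w)) * (1 - (2 : ℂ) • outer v v)

lemma unitaryRotation_mem_unitaryGroup (hv : ‖v‖ = 1) (hw : ‖w‖ = 1) (h : v ≠ -w) :
    unitaryRotation v w ∈ unitaryGroup ι ℂ := by
  have hne := inner_add_self_ne_zero hv hw h
  have hne' : inner ℂ v (v + w) ≠ 0 := by
    rwa [← inner_conj_symm, Ne, map_eq_zero]
  have huu : inner ℂ (v + w) (v + w) = inner ℂ (v + w) v + inner ℂ v (v + w) := by
    simp only [inner_add_left, inner_add_right, inner_self_of_norm_eq_one hv,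
      inner_self_of_norm_eq_one hw]
    ring
  refine mul_mem ?_ ?_
  · rw [mem_unitaryGroup_iff]
    simp only [star_sub, star_one, star_smul, star_outer, sub_mul, mul_sub, one_mul, mul_one,
      smul_mul_assoc, mul_smul_comm, outer_mul_outer, huu]
    simp only [star_inv₀, RCLike.star_def, inner_conj_symm, smul_smul]
    match_scalars
    · simp
    · field_simp
      ring
  · rw [mem_unitaryGroup_iff]
    simp only [star_sub, star_one, star_smul, star_outer, sub_mul, mul_sub, one_mul, mul_one,
      smul_mul_assoc, mul_smul_comm, outer_mul_outer, inner_self_of_norm_eq_one hv]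
    simp only [RCLike.star_def, Complex.conj_ofNat, smul_smul]
    match_scalars <;> norm_num

lemma unitaryRotation_mulVec (hv : ‖v‖ = 1) (hw : ‖w‖ = 1) (h : v ≠ -w) :
    unitaryRotation v w *ᵥ v.ofLp = w.ofLp := by
  have hne := inner_add_self_ne_zero hv hw h
  have h2 : (1 - (2 : ℂ) • outer v v) *ᵥ v.ofLp = (-v).ofLp := by
    rw [sub_mulVec, one_mulVec, smul_mulVec, outer_mulVec, inner_self_of_norm_eq_one hv]
    ext i; simp; ring
  rw [unitaryRotation, ← mulVec_mulVec, h2, sub_mulVec, one_mulVec, smul_mulVec, outer_mulVec,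
    inner_neg_right]
  generalize inner ℂ (v + w) v = a at hne
  ext i
  simp [hne]

lemma unitaryRotation_mulVec_of_inner_eq_zero {x : EuclideanSpace ℂ ι} (hv : inner ℂ v x = 0)
    (hw : inner ℂ w x = 0) : unitaryRotation v w *ᵥ x.ofLp = x.ofLp := by
  have h2 : (1 - (2 : ℂ) • outer v v) *ᵥ x.ofLp = x.ofLp := by
    rw [sub_mulVec, one_mulVec, smul_mulVec, outer_mulVec, hv]; simp
  rw [unitaryRotation, ← mulVec_mulVec, h2, sub_mulVec, one_mulVec, smul_mulVec, outer_mulVec,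
    inner_add_left (x := v) (z := x), hv, hw]
  simp

lemma unitaryRotation_self (hv : ‖v‖ = 1) : unitaryRotation v v = 1 := by
  have h1 := inner_self_of_norm_eq_one hv
  have h2 : outer (v + v) (v + v) = (4 : ℂ) • outer v v := by
    ext i j; simp [outer, vecMulVec_apply]; ring
  rw [unitaryRotation, h2]
  simp only [inner_add_left, h1, sub_mul, mul_sub, one_mul, mul_one,
      smul_mul_assoc, mul_smul_comm, outer_mul_outer]
  match_scalars <;> norm_num

lemma continuous_unitaryRotation {X : Type*} [TopologicalSpace X] {v w : X → EuclideanSpace ℂ ι}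
    (hv : Continuous v) (hw : Continuous w) (hv1 : ∀ x, ‖v x‖ = 1) (hw1 : ∀ x, ‖w x‖ = 1)
    (h : ∀ x, v x ≠ -w x) : Continuous fun x => unitaryRotation (v x) (w x) := by
  have h1 : Continuous fun x => (inner ℂ (v x + w x) (v x))⁻¹ :=
    (Continuous.inner (hv.add hw) hv).inv₀ fun x => inner_add_self_ne_zero (hv1 x) (hw1 x) (h x)
  exact (continuous_const.sub (h1.smul (continuous_outer (hv.add hw) (hv.add hw)))).mul
    (continuous_const.sub ((continuous_outer hv hv).const_smul (2 : ℂ)))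

end UnitaryRotation

section Nullhomotopy

open unitInterval

variable {X : Type*} [TopologicalSpace X] {ι : Type*} [Fintype ι] [DecidableEq ι]

/-- The family of unitary matrices `f` is homotopic to the constant family `1` relative to `C`. -/
def UnitaryNullhomotopicRel (C : Set X) (f : X → Matrix ι ι ℂ) : Prop :=
  ∃ H : I × X → Matrix ι ι ℂ, Continuous H ∧ (∀ p, H p ∈ unitaryGroup ι ℂ) ∧
    (∀ x, H (0, x) = 1) ∧ (∀ x, H (1, x) = f x) ∧ ∀ t, ∀ x ∈ C, H (t, x) = 1

namespace UnitaryNullhomotopicRel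

variable {C : Set X} {f g : X → Matrix ι ι ℂ}

lemma one : UnitaryNullhomotopicRel C fun _ => (1 : Matrix ι ι ℂ) :=
  ⟨fun _ => 1, continuous_const, fun _ => one_mem _, by simp, by simp, by simp⟩

lemma mul (hf : UnitaryNullhomotopicRel C f) (hg : UnitaryNullhomotopicRel C g) :
    UnitaryNullhomotopicRel C fun x => f x * g x := by
  obtain ⟨F, hF, hFu, hF0, hF1, hFC⟩ := hf
  obtain ⟨G, hG, hGu, hG0, hG1, hGC⟩ := hg
  refine ⟨fun p => F p * G p, hF.mul hG, fun p => mul_mem (hFu p) (hGu p), ?_, ?_, ?_⟩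
  · simp [hF0, hG0]
  · simp [hF1, hG1]
  · intro t x hx; simp [hFC t x hx, hGC t x hx]

lemma inv (hf : UnitaryNullhomotopicRel C f) :
    UnitaryNullhomotopicRel C fun x => star (f x) := by
  obtain ⟨F, hF, hFu, hF0, hF1, hFC⟩ := hf
  refine ⟨fun p => star (F p), hF.star, fun p => Unitary.star_mem (hFu p), ?_, ?_, ?_⟩
  · simp [hF0]
  · simp [hF1]
  · intro t x hx; simp [hFC t x hx]

lemma continuous (hf : UnitaryNullhomotopicRel C f) : Continuous f := by
  obtain ⟨F, hF, -, -, hF1, -⟩ := hf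
  simpa [Function.comp_def, hF1] using hF.comp (Continuous.prodMk_right (1 : I))

lemma mem_unitaryGroup (hf : UnitaryNullhomotopicRel C f) (x : X) : f x ∈ unitaryGroup ι ℂ := by
  obtain ⟨F, -, hFu, -, hF1, -⟩ := hf
  exact hF1 x ▸ hFu _

lemma eq_one (hf : UnitaryNullhomotopicRel C f) {x : X} (hx : x ∈ C) : f x = 1 := by
  obtain ⟨F, -, -, -, hF1, hFC⟩ := hf
  exact hF1 x ▸ hFC 1 x hx

end UnitaryNullhomotopicRel

section

variable {V : Type*} [NormedAddCommGroup V] [NormedSpace ℝ V]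

/-- The radial projection of the segment from `v` to `w` to the unit sphere. -/
noncomputable def sphereSegment (t : ℝ) (v w : V) : V :=
  ‖(1 - t) • v + t • w‖⁻¹ • ((1 - t) • v + t • w)

variable {v w : V} {t : ℝ}

lemma eq_neg_of_smul_add_smul_eq_neg_smul (hv : ‖v‖ = 1) (hw : ‖w‖ = 1) (ht : t ∈ I) {r : ℝ}
    (hr : 0 ≤ r) (h : (1 - t) • v + t • w = -(r • v)) : v = -w := by
  have h1 : (1 - t + r) • v = -(t • w) := by
    rw [← sub_eq_zero] at h ⊢
    rw [← h, add_smul]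
    abel
  have h2 : 1 - t + r = t := by
    have := congrArg norm h1
    rwa [norm_neg, norm_smul, norm_smul, hv, hw, mul_one, mul_one, Real.norm_of_nonneg ht.1,
      Real.norm_of_nonneg (by linarith [ht.2])] at this
  have ht0 : t ≠ 0 := by rintro rfl; linarith
  rw [h2, ← smul_neg] at h1
  exact smul_right_injective V ht0 h1

lemma segment_ne_zero (hv : ‖v‖ = 1) (hw : ‖w‖ = 1) (h : v ≠ -w) (ht : t ∈ I) :
    (1 - t) • v + t • w ≠ 0 := fun h0 =>
  h (eq_neg_of_smul_add_smul_eq_neg_smul hv hw ht le_rfl (by simpa using h0))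

lemma norm_sphereSegment (hv : ‖v‖ = 1) (hw : ‖w‖ = 1) (h : v ≠ -w) (ht : t ∈ I) :
    ‖sphereSegment t v w‖ = 1 := by
  rw [sphereSegment, norm_smul, norm_inv, norm_norm,
    inv_mul_cancel₀ (norm_ne_zero_iff.mpr (segment_ne_zero hv hw h ht))]

lemma ne_neg_sphereSegment (hv : ‖v‖ = 1) (hw : ‖w‖ = 1) (h : v ≠ -w) (ht : t ∈ I) :
    v ≠ -sphereSegment t v w := by
  intro h0
  refine h (eq_neg_of_smul_add_smul_eq_neg_smul hv hw ht
    (norm_nonneg ((1 - t) • v + t • w)) ?_)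
  have h1 : ‖(1 - t) • v + t • w‖ • v = -((1 - t) • v + t • w) := by
    conv_lhs => arg 2; rw [h0, sphereSegment]
    rw [smul_neg, smul_inv_smul₀]
    exact norm_ne_zero_iff.mpr (segment_ne_zero hv hw h ht)
  rw [h1, neg_neg]

lemma sphereSegment_zero (hv : ‖v‖ = 1) : sphereSegment 0 v w = v := by
  simp [sphereSegment, hv]

lemma sphereSegment_one (hw : ‖w‖ = 1) : sphereSegment 1 v w = w := by
  simp [sphereSegment, hw]

end

/-- The rotations between two families of unit vectors that are nowhere antipodal are
nullhomotopic, once normalised on a set where both families are constant. -/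
lemma unitaryNullhomotopicRel_unitaryRotation {C : Set X} {c d : X → EuclideanSpace ℂ ι}
    {e e' : EuclideanSpace ℂ ι} (hc : Continuous c) (hd : Continuous d)
    (hc1 : ∀ x, ‖c x‖ = 1) (hd1 : ∀ x, ‖d x‖ = 1) (h : ∀ x, c x ≠ -d x)
    (he : ‖e‖ = 1) (he' : ‖e'‖ = 1) (hee' : e ≠ -e')
    (hcC : ∀ x ∈ C, c x = e) (hdC : ∀ x ∈ C, d x = e') :
    UnitaryNullhomotopicRel C fun x =>
      star (unitaryRotation e e') * unitaryRotation (c x) (d x) := by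
  have key : ∀ {Y : Type _} [TopologicalSpace Y] {c d : Y → EuclideanSpace ℂ ι},
      Continuous c → Continuous d → (∀ x, ‖c x‖ = 1) → (∀ x, ‖d x‖ = 1) →
      (∀ x, c x ≠ -d x) →
      Continuous fun p : I × Y => unitaryRotation (c p.2) (sphereSegment p.1 (c p.2) (d p.2)) := by
    intro Y _ c d hc hd hc1 hd1 h
    have hs : Continuous fun p : I × Y => (1 - (p.1 : ℝ)) • c p.2 + (p.1 : ℝ) • d p.2 := by
      fun_prop
    refine continuous_unitaryRotation (by fun_prop) ?_ (fun p => hc1 _)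
      (fun p => norm_sphereSegment (hc1 _) (hd1 _) (h _) p.1.2)
      (fun p => ne_neg_sphereSegment (hc1 _) (hd1 _) (h _) p.1.2)
    exact (hs.norm.inv₀ fun p => norm_ne_zero_iff.mpr
      (segment_ne_zero (hc1 _) (hd1 _) (h _) p.1.2)).smul hs
  have hE : Continuous fun p : I × X => unitaryRotation e (sphereSegment p.1 e e') :=
    key (Y := X) (c := fun _ => e) (d := fun _ => e') continuous_const continuous_const
      (fun _ => he) (fun _ => he') (fun _ => hee')
  have hmem : ∀ {v w : EuclideanSpace ℂ ι} (t : I), ‖v‖ = 1 → ‖w‖ = 1 → v ≠ -w →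
      unitaryRotation v (sphereSegment t v w) ∈ unitaryGroup ι ℂ := fun t hv hw h =>
    unitaryRotation_mem_unitaryGroup hv (norm_sphereSegment hv hw h t.2)
      (ne_neg_sphereSegment hv hw h t.2)
  refine ⟨fun p => star (unitaryRotation e (sphereSegment p.1 e e')) *
    unitaryRotation (c p.2) (sphereSegment p.1 (c p.2) (d p.2)), hE.star.mul (key hc hd hc1 hd1 h),
    fun p => mul_mem (Unitary.star_mem (hmem p.1 he he' hee'))
      (hmem p.1 (hc1 _) (hd1 _) (h _)), ?_, ?_, ?_⟩
  · intro x
    simp [sphereSegment_zero, he, hc1, unitaryRotation_self]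
  · intro x
    simp [sphereSegment_one, he', hd1]
  · intro t x hx
    simp only [hcC x hx, hdC x hx]
    exact mem_unitaryGroup_iff'.mp (hmem t he he' hee')

end Nullhomotopy

section Approximation

open Module

variable {E : Type*} [NormedAddCommGroup E] [NormedSpace ℝ E] [FiniteDimensional ℝ E]
  {ι : Type*} [Fintype ι]

/-- A family of unit vectors in the coordinate subspace complementary to `S` that is constant on
`C` can be approximated, rel `C`, by a smooth family with values in that subspace. -/
lemma exists_contDiff_approx {C : Set E} (hC : IsClosed C) {c : E → EuclideanSpace ℂ ι}
    (hc : Continuous c) {S : Finset ι} (hcS : ∀ x, ∀ i ∈ S, c x i = 0)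
    {e : EuclideanSpace ℂ ι} (hcC : ∀ x ∈ C, c x = e) :
    ∃ d : E → EuclideanSpace ℂ ι, ContDiff ℝ 1 d ∧
      ∀ x, ‖d x - c x‖ < 1 ∧ (∀ i ∈ S, d x i = 0) ∧ (x ∈ C → d x = e) := by
  let t : E → Set (EuclideanSpace ℂ ι) := fun x =>
    {y | ‖y - c x‖ < 1 ∧ (∀ i ∈ S, y i = 0) ∧ (x ∈ C → y = e)}
  have ht : ∀ x, Convex ℝ (t x) := by
    intro x y hy z hz a b ha hb hab
    refine ⟨?_, fun i hi => ?_, fun hx => ?_⟩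
    · exact mem_ball_iff_norm.mp (convex_ball (c x) 1 (mem_ball_iff_norm.mpr hy.1)
        (mem_ball_iff_norm.mpr hz.1) ha hb hab)
    · simp [hy.2.1 i hi, hz.2.1 i hi]
    · rw [hy.2.2 hx, hz.2.2 hx, ← add_smul, hab, one_smul]
  have hloc : ∀ x, ∃ y, ∀ᶠ x' in 𝓝 x, y ∈ t x' := by
    intro x
    have hx : ∀ᶠ y in 𝓝 x, ‖c x - c y‖ < 1 := by
      have : Continuous fun y => ‖c x - c y‖ := by fun_prop
      exact this.continuousAt.eventually_lt continuousAt_const (by simp)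
    refine ⟨c x, ?_⟩
    by_cases hxC : x ∈ C
    · exact hx.mono fun y hy => ⟨hy, hcS x, fun _ => hcC x hxC⟩
    · filter_upwards [hx, hC.isOpen_compl.mem_nhds hxC] with y hy hyC
      exact ⟨hy, hcS x, fun h => absurd h hyC⟩
  obtain ⟨g, hg⟩ := exists_contMDiffMap_forall_mem_convex_of_local_const (n := 1) 𝓘(ℝ, E) ht hloc
  exact ⟨g, g.contMDiff.contDiff, hg⟩

variable [DecidableEq ι]

/-- A smooth family of vectors on a plane has values that miss some real line spanned by a vector
supported on two given coordinates. -/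
lemma exists_unit_vector_forall_smul_ne (hE : finrank ℝ E ≤ 2) {d : E → EuclideanSpace ℂ ι}
    (hd : ContDiff ℝ 1 d) {j k : ι} (hjk : j ≠ k) :
    ∃ w : EuclideanSpace ℂ ι, ‖w‖ = 1 ∧ (∀ i, i ≠ j → i ≠ k → w i = 0) ∧
      ∀ x, ∀ t : ℝ, t • d x ≠ w := by
  have hF : ContDiff ℝ 1 fun p : E × ℝ => (p.2 • d p.1 j, p.2 • d p.1 k) := by
    have h : ∀ i, ContDiff ℝ 1 fun p : E × ℝ => p.2 • d p.1 i := fun i =>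
      contDiff_snd.smul ((contDiff_piLp 2).mp (hd.comp contDiff_fst) i)
    exact (h j).prodMk (h k)
  have hdim : finrank ℝ (E × ℝ) < finrank ℝ (ℂ × ℂ) := by
    simp [finrank_prod, Complex.finrank_real_complex]; omega
  obtain ⟨⟨a, b⟩, hab⟩ := (hF.dense_compl_range_of_finrank_lt_finrank hdim).nonempty
  set u : EuclideanSpace ℂ ι := EuclideanSpace.single j a + EuclideanSpace.single k b with hu
  have huj : u j = a := by simp [hu, hjk]
  have huk : u k = b := by simp [hu, hjk.symm]
  have hmiss : ∀ x, ∀ t : ℝ, t • d x ≠ u := by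
    intro x t h
    refine hab ⟨(x, t), ?_⟩
    simp only [← huj, ← huk, ← h, PiLp.smul_apply]
  have hu0 : u ≠ 0 := fun h => hmiss 0 0 (by simp [h])
  have hun : ‖u‖ ≠ 0 := norm_ne_zero_iff.mpr hu0
  refine ⟨‖u‖⁻¹ • u, by rw [norm_smul, norm_inv, norm_norm, inv_mul_cancel₀ hun],
    fun i hij hik => ?_, fun x t h => ?_⟩
  · simp [hu, hij, hik]
  · refine hmiss x (‖u‖ * t) ?_
    rw [mul_smul, h, smul_inv_smul₀ hun]

/-- A family of unit vectors over a plane can be approximated, rel `C` and within a coordinate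
subspace of complex dimension at least two, by a family of unit vectors missing a point. -/
lemma exists_unit_approx_forall_ne (hE : finrank ℝ E ≤ 2) {C : Set E} (hC : IsClosed C)
    {c : E → EuclideanSpace ℂ ι} (hc : Continuous c) (hc1 : ∀ x, ‖c x‖ = 1) {S : Finset ι}
    (hcS : ∀ x, ∀ i ∈ S, c x i = 0) {e : EuclideanSpace ℂ ι} (he : ‖e‖ = 1)
    (hcC : ∀ x ∈ C, c x = e) {j k : ι} (hjk : j ≠ k) (hj : j ∉ S) (hk : k ∉ S) :
    ∃ d : E → EuclideanSpace ℂ ι, Continuous d ∧ (∀ x, ‖d x‖ = 1) ∧ (∀ x, c x ≠ -d x) ∧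
      (∀ x, ∀ i ∈ S, d x i = 0) ∧ (∀ x ∈ C, d x = e) ∧
      ∃ w : EuclideanSpace ℂ ι, ‖w‖ = 1 ∧ (∀ i ∈ S, w i = 0) ∧ ∀ x, d x ≠ -w := by
  obtain ⟨d, hd, hdc⟩ := exists_contDiff_approx hC hc hcS hcC
  obtain ⟨w, hw1, hw, hwd⟩ := exists_unit_vector_forall_smul_ne hE hd hjk
  have hd0 : ∀ x, d x ≠ 0 := by
    intro x h
    have := (hdc x).1
    simp [h, hc1] at this
  have hn : ∀ x, ‖d x‖ ≠ 0 := fun x => norm_ne_zero_iff.mpr (hd0 x)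
  refine ⟨fun x => ‖d x‖⁻¹ • d x, (hd.continuous.norm.inv₀ hn).smul hd.continuous,
    fun x => by rw [norm_smul, norm_inv, norm_norm, inv_mul_cancel₀ (hn x)],
    fun x h => ?_, fun x i hi => ?_, fun x hx => ?_,
    w, hw1, fun i hi => hw i (ne_of_mem_of_not_mem hi hj) (ne_of_mem_of_not_mem hi hk),
    fun x h => hwd x (-‖d x‖⁻¹) ?_⟩
  · have h1 : d x - c x = (1 + ‖d x‖⁻¹) • d x := by rw [h]; module
    have h2 := (hdc x).1
    have h3 : 0 < ‖d x‖ := (norm_nonneg _).lt_of_ne' (hn x)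
    rw [h1, norm_smul, Real.norm_of_nonneg (by positivity), add_mul, inv_mul_cancel₀ (hn x)] at h2
    linarith
  · simp [(hdc x).2.1 i hi]
  · simp [(hdc x).2.2 hx, he]
  · rw [neg_smul, neg_eq_iff_eq_neg]; exact h

end Approximation

section Reduction

open Module

variable {ι : Type*} [DecidableEq ι]

/-- The diagonal matrix with entry `a` at `j` and `1` elsewhere. -/
def diagonalAt (j : ι) (a : ℂ) : Matrix ι ι ℂ :=
  diagonal (Function.update 1 j a)

lemma diagonalAt_one (j : ι) : diagonalAt j 1 = 1 := by
  simp [diagonalAt]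

variable [Fintype ι] {E : Type*} [NormedAddCommGroup E] [NormedSpace ℝ E] [FiniteDimensional ℝ E]

lemma star_mulVec_of_mulVec {A : Matrix ι ι ℂ} (hA : A ∈ unitaryGroup ι ℂ) {v w : ι → ℂ}
    (h : A *ᵥ v = w) : star A *ᵥ w = v := by
  rw [← h, mulVec_mulVec, mem_unitaryGroup_iff'.mp hA, one_mulVec]

lemma apply_eq_zero_of_mulVec_single {A : Matrix ι ι ℂ} (hA : A ∈ unitaryGroup ι ℂ) {i k : ι}
    (hik : k ≠ i) (h : A *ᵥ Pi.single i 1 = Pi.single i 1) : A i k = 0 := by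
  have := congrFun (star_mulVec_of_mulVec hA h) k
  simpa [hik, star_eq_conjTranspose] using this

lemma unitaryRotation_mulVec_single {v w : EuclideanSpace ℂ ι} {i : ι} (hv : v i = 0)
    (hw : w i = 0) : unitaryRotation v w *ᵥ Pi.single i 1 = Pi.single i 1 := by
  refine unitaryRotation_mulVec_of_inner_eq_zero (x := EuclideanSpace.single i 1) ?_ ?_
  · simp [EuclideanSpace.inner_single_right, hv]
  · simp [EuclideanSpace.inner_single_right, hw]

/-- A family of unitary matrices over a plane that fixes the coordinate vectors in `S` can be
modified by a nullhomotopic family so that it fixes one more coordinate vector `k`, as long as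
there is another coordinate left. -/
lemma exists_nullhomotopic_mul_fix (hE : finrank ℝ E ≤ 2) {C : Set E} (hC : IsClosed C)
    (hCne : C.Nonempty) {f : E → Matrix ι ι ℂ} (hf : Continuous f)
    (hfu : ∀ x, f x ∈ unitaryGroup ι ℂ) (hfC : ∀ x ∈ C, f x = 1) {S : Finset ι}
    (hfS : ∀ x, ∀ i ∈ S, f x *ᵥ Pi.single i 1 = Pi.single i 1) {j k : ι} (hjk : j ≠ k)
    (hj : j ∉ S) (hk : k ∉ S) :
    ∃ g : E → Matrix ι ι ℂ, UnitaryNullhomotopicRel C g ∧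
      ∀ x, ∀ i ∈ insert k S, (g x * f x) *ᵥ Pi.single i 1 = Pi.single i 1 := by
  set e : EuclideanSpace ℂ ι := EuclideanSpace.single k 1 with he_def
  have he : ‖e‖ = 1 := by simp [he_def]
  have heS : ∀ i ∈ S, e i = 0 := fun i hi => by
    simp [he_def, ne_of_mem_of_not_mem hi hk]
  set c : E → EuclideanSpace ℂ ι := fun x => WithLp.toLp 2 (f x *ᵥ Pi.single k 1) with hc_def
  have hc : Continuous c :=
    (PiLp.continuous_toLp 2 _).comp (hf.matrix_mulVec continuous_const)
  have hc1 : ∀ x, ‖c x‖ = 1 := by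
    intro x
    have h : inner ℂ (c x) (c x) = 1 := by
      rw [EuclideanSpace.inner_eq_star_dotProduct, dotProduct_comm]
      simp only [hc_def]
      rw [star_mulVec, ← dotProduct_mulVec, mulVec_mulVec, ← star_eq_conjTranspose,
        mem_unitaryGroup_iff'.mp (hfu x)]
      simp
    have h' : ‖c x‖ ^ 2 = 1 := by rw [← inner_self_eq_norm_sq (𝕜 := ℂ), h]; simp
    exact (pow_eq_one_iff_of_nonneg (norm_nonneg _) two_ne_zero).mp h'
  have hcS : ∀ x, ∀ i ∈ S, c x i = 0 := fun x i hi => by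
    simpa [hc_def] using apply_eq_zero_of_mulVec_single (hfu x)
      (ne_of_mem_of_not_mem hi hk).symm (hfS x i hi)
  have hcC : ∀ x ∈ C, c x = e := fun x hx => by
    ext i; simp [hc_def, he_def, hfC x hx, one_apply]
  obtain ⟨d, hd, hd1, hcd, hdS, hdC, w, hw1, hwS, hdw⟩ :=
    exists_unit_approx_forall_ne hE hC hc hc1 hcS he hcC hjk hj hk
  have hew : e ≠ -w := by
    obtain ⟨x, hx⟩ := hCne
    exact hdC x hx ▸ hdw x
  have hee : e ≠ -e := fun h => by
    have := congrArg (fun v : EuclideanSpace ℂ ι => (v k).re) h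
    simp only [he_def, PiLp.neg_apply, PiLp.single_apply, if_true, Complex.neg_re,
      Complex.one_re] at this
    linarith
  have h1 := unitaryNullhomotopicRel_unitaryRotation hc hd hc1 hd1 hcd he he hee hcC hdC
  have h2 := unitaryNullhomotopicRel_unitaryRotation (C := C) hd continuous_const hd1
    (fun _ => hw1) hdw he hw1 hew hdC (fun _ _ => rfl)
  have hewu := unitaryRotation_mem_unitaryGroup he hw1 hew
  refine ⟨_, h2.mul h1, fun x i hi => ?_⟩
  simp only [unitaryRotation_self he, star_one, one_mul, ← mulVec_mulVec]
  rcases Finset.mem_insert.mp hi with rfl | hi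
  · rw [show f x *ᵥ Pi.single i 1 = (c x).ofLp from rfl,
      unitaryRotation_mulVec (hc1 x) (hd1 x) (hcd x),
      unitaryRotation_mulVec (hd1 x) hw1 (hdw x)]
    exact star_mulVec_of_mulVec hewu (unitaryRotation_mulVec he hw1 hew)
  · rw [hfS x i hi, unitaryRotation_mulVec_single (hcS x i hi) (hdS x i hi),
      unitaryRotation_mulVec_single (hdS x i hi) (hwS i hi)]
    exact star_mulVec_of_mulVec hewu (unitaryRotation_mulVec_single (heS i hi) (hwS i hi))

/-- A family of unitary matrices over a plane can be modified by a nullhomotopic family so that it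
fixes all coordinate vectors in a given proper set of coordinates. -/
lemma exists_nullhomotopic_mul_fix_finset (hE : finrank ℝ E ≤ 2) {C : Set E} (hC : IsClosed C)
    (hCne : C.Nonempty) {f : E → Matrix ι ι ℂ} (hf : Continuous f)
    (hfu : ∀ x, f x ∈ unitaryGroup ι ℂ) (hfC : ∀ x ∈ C, f x = 1) {j : ι} (S : Finset ι)
    (hj : j ∉ S) :
    ∃ g : E → Matrix ι ι ℂ, UnitaryNullhomotopicRel C g ∧
      ∀ x, ∀ i ∈ S, (g x * f x) *ᵥ Pi.single i 1 = Pi.single i 1 := by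
  induction S using Finset.induction_on with
  | empty => exact ⟨_, .one, by simp⟩
  | insert k S hk ih =>
    rw [Finset.mem_insert, not_or] at hj
    obtain ⟨g, hg, hgS⟩ := ih hj.2
    obtain ⟨g', hg', hgS'⟩ := exists_nullhomotopic_mul_fix hE hC hCne
      (f := fun x => g x * f x) (hg.continuous.mul hf)
      (fun x => mul_mem (hg.mem_unitaryGroup x) (hfu x))
      (fun x hx => by rw [hg.eq_one hx, hfC x hx, one_mul]) hgS hj.1 hj.2 hk
    exact ⟨_, hg'.mul hg, by simpa only [mul_assoc] using hgS'⟩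

lemma det_diagonalAt (j : ι) (a : ℂ) : (diagonalAt j a).det = a := by
  rw [diagonalAt, det_diagonal, Finset.prod_update_of_mem (Finset.mem_univ j)]
  simp

lemma diagonalAt_mul (j : ι) (a b : ℂ) :
    diagonalAt j a * diagonalAt j b = diagonalAt j (a * b) := by
  rw [diagonalAt, diagonalAt, diagonalAt, diagonal_mul_diagonal]
  congr 1
  ext i
  by_cases h : i = j
  · subst h; simp
  · simp [h]

lemma diagonalAt_mem_unitaryGroup (j : ι) {a : ℂ} (ha : a ∈ unitary ℂ) :
    diagonalAt j a ∈ unitaryGroup ι ℂ := by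
  have : star (diagonalAt j a) = diagonalAt j (star a) := by
    rw [diagonalAt, diagonalAt, star_eq_conjTranspose, diagonal_conjTranspose]
    congr 1
    ext i
    by_cases h : i = j
    · subst h; simp
    · simp [h]
  rw [mem_unitaryGroup_iff, this, diagonalAt_mul, Unitary.mul_star_self_of_mem ha, diagonalAt_one]

/-- A unitary matrix that fixes all coordinate vectors but one is determined by its
determinant. -/
lemma eq_diagonalAt_det {A : Matrix ι ι ℂ} (hA : A ∈ unitaryGroup ι ℂ) {j : ι}
    (h : ∀ i ≠ j, A *ᵥ Pi.single i 1 = Pi.single i 1) : A = diagonalAt j A.det := by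
  have : A = diagonalAt j (A j j) := by
    ext a b
    by_cases hb : b = j
    · subst hb
      by_cases hab : a = b
      · subst hab; simp [diagonalAt]
      · rw [apply_eq_zero_of_mulVec_single hA (Ne.symm hab) (h a hab)]
        simp [diagonalAt, hab]
    · have := congrFun (h b hb) a
      simp only [mulVec_single_one, col_apply] at this
      rw [this, diagonalAt, diagonal_apply, Pi.single_apply]
      split_ifs with hab <;> simp [hab, hb]
  rw [this, det_diagonalAt]

/-- Multiply the `j`-th column of a matrix by the conjugate of the determinant. -/
noncomputable def normalizeDet (j : ι) (A : Matrix ι ι ℂ) : Matrix ι ι ℂ :=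
  A * diagonalAt j (star A.det)

lemma normalizeDet_mem (j : ι) {A : Matrix ι ι ℂ} (hA : A ∈ unitaryGroup ι ℂ) :
    normalizeDet j A ∈ specialUnitaryGroup ι ℂ := by
  have hdet := det_of_mem_unitary hA
  rw [mem_specialUnitaryGroup_iff]
  refine ⟨mul_mem hA (diagonalAt_mem_unitaryGroup j (Unitary.star_mem hdet)), ?_⟩
  rw [normalizeDet, det_mul, det_diagonalAt, Unitary.mul_star_self_of_mem hdet]

lemma normalizeDet_one (j : ι) : normalizeDet j (1 : Matrix ι ι ℂ) = 1 := by
  simp [normalizeDet, diagonalAt_one]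

lemma continuous_normalizeDet (j : ι) : Continuous (normalizeDet (ι := ι) j) := by
  unfold normalizeDet diagonalAt
  exact continuous_id.mul (Continuous.matrix_diagonal
    (continuous_const.update j continuous_id.matrix_det.star))

/-- A family of special unitary matrices over a plane that is trivial on a nonempty closed set `C`
is the image under `normalizeDet` of a family of unitary matrices nullhomotopic rel `C`. -/
lemma exists_nullhomotopic_normalizeDet_eq (hE : finrank ℝ E ≤ 2) {C : Set E} (hC : IsClosed C)
    (hCne : C.Nonempty) {f : E → Matrix ι ι ℂ} (hf : Continuous f)
    (hfu : ∀ x, f x ∈ specialUnitaryGroup ι ℂ) (hfC : ∀ x ∈ C, f x = 1) (j : ι) :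
    ∃ g : E → Matrix ι ι ℂ, UnitaryNullhomotopicRel C g ∧ ∀ x, normalizeDet j (g x) = f x := by
  obtain ⟨g, hg, hgf⟩ := exists_nullhomotopic_mul_fix_finset hE hC hCne hf
    (fun x => (mem_specialUnitaryGroup_iff.mp (hfu x)).1) hfC (Finset.univ.erase j)
    (Finset.notMem_erase j _)
  refine ⟨_, hg.inv, fun x => ?_⟩
  have hfx := mem_specialUnitaryGroup_iff.mp (hfu x)
  have hgx := hg.mem_unitaryGroup x
  have h := eq_diagonalAt_det (mul_mem hgx hfx.1) (j := j)
    fun i hi => hgf x i (by simpa using hi)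
  rw [det_mul, hfx.2, mul_one] at h
  rw [normalizeDet, star_eq_conjTranspose, det_conjTranspose, star_star, ← h, ← mul_assoc,
    ← star_eq_conjTranspose, mem_unitaryGroup_iff'.mp hgx, one_mul]

end Reduction

section Homotopy

open unitInterval

/-- The second homotopy group of a special unitary group is trivial. -/
lemma subsingleton_pi_two_specialUnitaryGroup {ι : Type*} [Fintype ι] [DecidableEq ι]
    [Nonempty ι] : Subsingleton (π_ 2 (specialUnitaryGroup ι ℂ) 1) := by
  have j : ι := Classical.arbitrary ι
  suffices h : ∀ f : GenLoop (Fin 2) (specialUnitaryGroup ι ℂ) 1,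
      GenLoop.Homotopic GenLoop.const f by
    refine ⟨fun a b => ?_⟩
    induction a using Quotient.inductionOn with | _ f
    induction b using Quotient.inductionOn with | _ g
    exact Quotient.sound ((h f).symm.trans (h g))
  intro f
  let clamp : (Fin 2 → ℝ) → (Fin 2 → I) := fun x i => Set.projIcc 0 1 zero_le_one (x i)
  have hclamp : Continuous clamp := by
    refine continuous_pi fun i => continuous_projIcc.comp (continuous_apply i)
  let incl : (Fin 2 → I) → (Fin 2 → ℝ) := fun x i => x i
  have hincl : Continuous incl := by fun_prop
  have hci : ∀ x, clamp (incl x) = x := fun x => by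
    ext i; simp [clamp, incl]
  let C : Set (Fin 2 → ℝ) := clamp ⁻¹' Cube.boundary (Fin 2)
  have hC : IsClosed C := by
    refine IsClosed.preimage hclamp ?_
    simp only [Cube.boundary, Set.ofPred_exists]
    exact isClosed_iUnion_of_finite fun i =>
      (isClosed_eq (continuous_apply i) continuous_const).union
        (isClosed_eq (continuous_apply i) continuous_const)
  have hCne : C.Nonempty := ⟨0, 0, Or.inl (by simp [clamp])⟩
  obtain ⟨g, ⟨H, hH, hHu, hH0, hH1, hHC⟩, hg⟩ := exists_nullhomotopic_normalizeDet_eq (by simp) hC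
    hCne (f := fun x => (f (clamp x) : Matrix ι ι ℂ))
    (continuous_subtype_val.comp (f.1.continuous.comp hclamp)) (fun x => (f (clamp x)).2)
    (fun x hx => congrArg Subtype.val (f.2 _ hx)) j
  refine ⟨⟨⟨⟨fun p => ⟨normalizeDet j (H (p.1, incl p.2)), normalizeDet_mem j (hHu _)⟩, ?_⟩,
    fun x => ?_, fun x => ?_⟩, fun t x hx => ?_⟩⟩
  · exact ((continuous_normalizeDet j).comp (hH.comp (by fun_prop))).subtype_mk _
  · ext1
    simp [hH0, normalizeDet_one, GenLoop.const]
  · ext1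
    simp only [hH1, hg, hci]
    rfl
  · ext1
    have : incl x ∈ C := by simpa [C, hci] using hx
    simp [hHC t _ this, normalizeDet_one, GenLoop.const]

end Homotopy

/-- The second homotopy group of `SU(8)` based at the identity is trivial. -/
theorem pi2_SU8_trivial :
    Subsingleton (π_ 2 (Matrix.specialUnitaryGroup (Fin 8) ℂ) 1) := by
  exact subsingleton_pi_two_specialUnitaryGroup
end
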